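/- Let A be a commutative Noetherian ring of dimension d containing an infinite field k, with singular locus of Spec(A) equal to V(𝒥) where ht 𝒥 ≥ d − n + 2 and 2n ≥ d + 3. Let I ⊆ A[T] be an ideal of height n and φ : A[T]^n ↠ I/I²T a surjection. Define N(I; φ) = { s ∈ A : φ ⊗ A_s[T] lifts to a surjection A_s[T]^n ↠ I_s }. Then N(I; φ) is an ideal of A. -/

import Mathlib

open Polynomial

/-- The height of an ideal: the infimum of the dimensions of localizations at primes
containing it. -/
noncomputable def idealHt {A : Type*} [CommRing A] (I : Ideal A) : WithBot (WithTop ℕ) :=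
  ⨅ p ∈ {p : PrimeSpectrum A | I ≤ p.asIdeal}, ringKrullDim (Localization.AtPrime p.asIdeal)

/-- A module has a unimodular element if some element is mapped to `1` by a linear functional. -/
def HasUnimodular (R M : Type*) [CommRing R] [AddCommGroup M] [Module R M] : Prop :=
  ∃ (m : M) (φ : M →ₗ[R] R), φ m = 1

/-- The local rank of a module at every prime, as a constant-rank condition. -/
def HasRank (R M : Type*) [CommRing R] [AddCommGroup M] [Module R M] (n : ℕ) : Prop :=
  ∀ p : PrimeSpectrum R,
    Module.rank (Localization.AtPrime p.asIdeal) (LocalizedModule p.asIdeal.primeCompl M) = n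

/-- `Spec A` is regular at the prime `p` if the maximal ideal of the (Noetherian) local ring
`A_p` is generated by `dim A_p` elements. -/
def RegularAt (A : Type*) [CommRing A] (p : PrimeSpectrum A) : Prop :=
  ∃ s : Finset (Localization.AtPrime p.asIdeal),
    Ideal.span (s : Set (Localization.AtPrime p.asIdeal)) = IsLocalRing.maximalIdeal _ ∧
    (s.card : WithBot (WithTop ℕ)) = ringKrullDim (Localization.AtPrime p.asIdeal)

theorem span_range_eq_of_forall_isMaximal {R ι : Type*} [CommRing R] {I : Ideal R} (hI : I.FG)
    {v : ι → R} (hv : ∀ k, v k ∈ I) (hsup : I ≤ Ideal.span (Set.range v) ⊔ I * I)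
    (hmax : ∀ M : Ideal R, M.IsMaximal → (∀ k, v k ∈ M) → I ≤ M) :
    Ideal.span (Set.range v) = I := by
  have hle : Ideal.span (Set.range v) ≤ I := Ideal.span_le.2 (by rintro _ ⟨k, rfl⟩; exact hv k)
  refine le_antisymm hle ?_
  obtain ⟨r, hr, hrI⟩ := Submodule.exists_sub_one_mem_and_smul_le_of_fg_of_le_sup
    (I := I) (N' := I) (N := Ideal.span (Set.range v)) hI le_rfl (by simpa using hsup)
  by_contra hcon
  have hne : (Ideal.span (Set.range v)).colon (I : Set R) ≠ ⊤ := by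
    intro h
    rw [Ideal.eq_top_iff_one, Submodule.mem_colon] at h
    exact hcon fun x hx => by simpa using h x hx
  obtain ⟨M, hM, hcM⟩ := Ideal.exists_le_maximal _ hne
  have hrM : r ∈ M := hcM (Submodule.mem_colon.2 fun x hx =>
    hrI (Submodule.smul_mem_pointwise_smul x r _ hx))
  have hIM : I ≤ M := hmax M hM fun k => hcM (Submodule.mem_colon.2 fun x _ =>
    Ideal.mul_mem_right _ _ (Ideal.subset_span ⟨k, rfl⟩))
  apply hM.ne_top
  rw [Ideal.eq_top_iff_one]
  simpa using M.sub_mem hrM (hIM hr)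

section PrimeAvoidance

variable {R : Type*} [CommRing R] [IsNoetherianRing R] {J W 𝔟 : Ideal R} {ρ : Ideal R → ℕ}

theorem exists_mem_forall_isPrime_succ_le
    (hρ : ∀ P Q : Ideal R, P.IsPrime → Q.IsPrime → J ≤ P → P < Q → ρ P < ρ Q) {k : ℕ}
    (hk : ∀ P : Ideal R, P.IsPrime → J ≤ P → W ≤ P → ¬ 𝔟 ≤ P → k ≤ ρ P) (b : R) :
    ∃ e ∈ 𝔟, ∀ P : Ideal R, P.IsPrime → J ≤ P → W ≤ P → b + e ∈ P → ¬ 𝔟 ≤ P → k + 1 ≤ ρ P := by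
  classical
  have hfin : (J ⊔ W).minimalPrimes.Finite := Ideal.finite_minimalPrimes_of_isNoetherianRing _ _
  obtain ⟨S, hS⟩ : ∃ S : Finset (Ideal R), ∀ Q, Q ∈ S ↔ Q ∈ (J ⊔ W).minimalPrimes ∧ ¬ 𝔟 ≤ Q :=
    ⟨hfin.toFinset.filter fun Q => ¬ 𝔟 ≤ Q, fun Q => by simp⟩
  obtain ⟨𝔞, h𝔞⟩ : ∃ 𝔞 : Ideal R, 𝔞 = 𝔟 * ∏ Q ∈ S.filter (fun Q => b ∉ Q), Q := ⟨_, rfl⟩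
  have h1 : ¬ ((𝔞 : Set R) ⊆ ⋃ Q ∈ (↑(S.filter (fun Q => b ∈ Q)) : Set (Ideal R)), (Q : Set R)) := by
    intro h
    rw [Ideal.subset_union_prime (f := fun Q : Ideal R => Q) ⊥ ⊥
      (fun Q hQ _ _ => ((hS Q).1 (Finset.mem_filter.1 hQ).1).1.1.1)] at h
    obtain ⟨Q, hQ, hle⟩ := h
    rw [Finset.mem_filter, hS] at hQ
    have hQp : Q.IsPrime := hQ.1.1.1.1
    rw [h𝔞] at hle
    rcases hQp.mul_le.1 hle with h | h
    · exact hQ.1.2 h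
    · obtain ⟨Q', hQ', hle'⟩ := (hQp.prod_le).1 h
      rw [Finset.mem_filter, hS] at hQ'
      have : Q' = Q := le_antisymm hle' (hQ.1.1.2 hQ'.1.1.1 hle')
      subst this; exact hQ'.2 hQ.2
  obtain ⟨e, he, hne⟩ := Set.not_subset.1 h1
  rw [h𝔞, SetLike.mem_coe] at he
  have he𝔟 : e ∈ 𝔟 := (Ideal.mul_le_left : 𝔟 * ∏ Q ∈ S.filter (fun Q => b ∉ Q), Q ≤ 𝔟) he
  have hne : ∀ Q ∈ S, b ∈ Q → e ∉ Q := fun Q hQ hb h =>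
    hne (Set.mem_biUnion (Finset.mem_coe.2 (Finset.mem_filter.2 ⟨hQ, hb⟩)) h)
  have hprod : ∀ Q ∈ S, b ∉ Q → e ∈ Q := by
    intro Q hQ hb
    have hdvd : Q ∣ 𝔟 * ∏ Q ∈ S.filter (fun Q => b ∉ Q), Q :=
      (Finset.dvd_prod_of_mem (fun Q => Q) (Finset.mem_filter.2 ⟨hQ, hb⟩)).mul_left _
    exact Ideal.le_of_dvd hdvd he
  refine ⟨e, he𝔟, fun P hP hJ hW hbe h𝔟 => ?_⟩
  obtain ⟨Q, hQ, hQP⟩ := Ideal.exists_minimalPrimes_le (sup_le hJ hW)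
  have hQ𝔟 : ¬ 𝔟 ≤ Q := fun h => h𝔟 (h.trans hQP)
  have hJQ : J ≤ Q := le_sup_left.trans hQ.1.2
  have hbQ : b + e ∉ Q := by
    by_cases hb : b ∈ Q
    · have := hne Q ((hS Q).2 ⟨hQ, hQ𝔟⟩) hb
      exact fun h => this ((Ideal.add_mem_iff_right _ hb).1 h)
    · have := hprod Q ((hS Q).2 ⟨hQ, hQ𝔟⟩) hb
      exact fun h => hb ((Ideal.add_mem_iff_left _ this).1 h)
  have hlt : Q < P := lt_of_le_of_ne hQP (by rintro rfl; exact hbQ hbe)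
  exact (Nat.succ_le_succ (hk Q hQ.1.1 hJQ (le_sup_right.trans hQ.1.2) hQ𝔟)).trans
    (hρ Q P hQ.1.1 hP hJQ hlt)

theorem exists_forall_mem_forall_isPrime_add_card_le
    (hρ : ∀ P Q : Ideal R, P.IsPrime → Q.IsPrime → J ≤ P → P < Q → ρ P < ρ Q) {k : ℕ}
    (hk : ∀ P : Ideal R, P.IsPrime → J ≤ P → W ≤ P → ¬ 𝔟 ≤ P → k ≤ ρ P)
    {ι : Type*} (b : ι → R) (T : Finset ι) :
    ∃ e : ι → R, (∀ i, e i ∈ 𝔟) ∧ (∀ i ∉ T, e i = 0) ∧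
      ∀ P : Ideal R, P.IsPrime → J ≤ P → W ≤ P → (∀ i ∈ T, b i + e i ∈ P) → ¬ 𝔟 ≤ P →
        k + T.card ≤ ρ P := by
  classical
  induction T using Finset.induction_on with
  | empty => exact ⟨0, fun i => 𝔟.zero_mem, fun i _ => rfl, fun P hP hJ hW _ h𝔟 => hk P hP hJ hW h𝔟⟩
  | insert a T ha ih =>
    obtain ⟨e, he𝔟, he0, he⟩ := ih
    obtain ⟨c, hc, hcP⟩ := exists_mem_forall_isPrime_succ_le (J := J) (𝔟 := 𝔟)
      (W := W ⊔ Ideal.span ((fun i => b i + e i) '' (T : Set ι))) hρ (k := k + T.card)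
      (fun P hP hJ hW h𝔟 => he P hP hJ (le_sup_left.trans hW)
        (fun i hi => hW (Ideal.mem_sup_right (Ideal.subset_span ⟨i, hi, rfl⟩))) h𝔟) (b a)
    refine ⟨Function.update e a c, fun i => ?_, fun i hi => ?_, fun P hP hJ hW hi h𝔟 => ?_⟩
    · by_cases h : i = a
      · subst h; simpa using hc
      · simpa [h] using he𝔟 i
    · rw [Finset.mem_insert, not_or] at hi
      rw [Function.update_of_ne hi.1, he0 i hi.2]
    · rw [Finset.card_insert_of_notMem ha, ← add_assoc]
      refine hcP P hP hJ (sup_le hW (Ideal.span_le.2 ?_)) ?_ h𝔟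
      · rintro _ ⟨i, hiT, rfl⟩
        have := hi i (Finset.mem_insert_of_mem hiT)
        rwa [Function.update_of_ne (by rintro rfl; exact ha hiT)] at this
      · simpa using hi a (Finset.mem_insert_self a T)

end PrimeAvoidance

section RowEquiv

open Matrix

variable {ι E F : Type*} [Fintype ι] [DecidableEq ι] [CommRing E] [CommRing F]

/-- The unipotent matrix `1 + a bᵗ` attached to orthogonal vectors `a` and `b`. -/
def rankOneUnipotent (a b : ι → E) (h : b ⬝ᵥ a = 0) : (Matrix ι ι E)ˣ where
  val := 1 + vecMulVec a b
  inv := 1 - vecMulVec a b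
  val_inv := by
    rw [mul_sub, add_mul (1 : Matrix ι ι E) _ (vecMulVec a b), vecMulVec_mul_vecMulVec, h]
    simp
  inv_val := by
    rw [mul_add, sub_mul (1 : Matrix ι ι E) _ (vecMulVec a b), vecMulVec_mul_vecMulVec, h]
    simp

/-- Two rows over `F` are equivalent relative to `𝔠` if they differ by the image of a matrix in
the principal congruence subgroup of level `𝔠` of `GL ι E`. -/
def RowEquiv (π : E →+* F) (𝔠 : Ideal E) (v v' : ι → F) : Prop :=
  ∃ Θ : (Matrix ι ι E)ˣ, (Ideal.Quotient.mk 𝔠).mapMatrix (Θ : Matrix ι ι E) = 1 ∧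
    v ᵥ* (π.mapMatrix (Θ : Matrix ι ι E)) = v'

variable {π : E →+* F} {𝔠 : Ideal E} {v v' v'' : ι → F}

theorem RowEquiv.refl (v : ι → F) : RowEquiv π 𝔠 v v :=
  ⟨1, by rw [Units.val_one, map_one], by rw [Units.val_one, map_one, vecMul_one]⟩

theorem RowEquiv.symm (h : RowEquiv π 𝔠 v v') : RowEquiv π 𝔠 v' v := by
  obtain ⟨Θ, h1, rfl⟩ := h
  refine ⟨Θ⁻¹, ?_, ?_⟩
  · rw [← one_mul ((Ideal.Quotient.mk 𝔠).mapMatrix ((Θ⁻¹ : (Matrix ι ι E)ˣ) : Matrix ι ι E)), ← h1,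
      ← map_mul, Units.mul_inv, map_one, h1]
  · rw [vecMul_vecMul, ← map_mul, Units.mul_inv, map_one, vecMul_one]

theorem RowEquiv.trans (h : RowEquiv π 𝔠 v v') (h' : RowEquiv π 𝔠 v' v'') :
    RowEquiv π 𝔠 v v'' := by
  obtain ⟨Θ, h1, rfl⟩ := h
  obtain ⟨Θ', h1', rfl⟩ := h'
  refine ⟨Θ * Θ', by rw [Units.val_mul, map_mul, h1, h1', one_mul], ?_⟩
  rw [vecMul_vecMul, Units.val_mul, map_mul]

theorem RowEquiv.of_vecMul (ε : (Matrix ι ι E)ˣ)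
    (h : RowEquiv π 𝔠 (v ᵥ* π.mapMatrix (ε : Matrix ι ι E))
      (v' ᵥ* π.mapMatrix (ε : Matrix ι ι E))) : RowEquiv π 𝔠 v v' := by
  obtain ⟨Θ, h1, h2⟩ := h
  refine ⟨ε * Θ * ε⁻¹, ?_, ?_⟩
  · rw [Units.val_mul, Units.val_mul, map_mul, map_mul, h1, mul_one, ← map_mul, Units.mul_inv,
      map_one]
  · rw [Units.val_mul, Units.val_mul, map_mul, map_mul, ← vecMul_vecMul, ← vecMul_vecMul, h2,
      vecMul_vecMul, ← map_mul, Units.mul_inv, map_one, vecMul_one]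

omit [Fintype ι] [DecidableEq ι] in
theorem map_vecMulVec (f : E →+* F) (a b : ι → E) :
    (vecMulVec a b).map f = vecMulVec (f ∘ a) (f ∘ b) := by
  ext i j; simp [vecMulVec_apply]

theorem vecMul_mapMatrix_rankOneUnipotent (a b : ι → E) (h : b ⬝ᵥ a = 0) :
    v ᵥ* π.mapMatrix (rankOneUnipotent a b h : Matrix ι ι E) =
       v + (v ⬝ᵥ (π ∘ a)) • (π ∘ b) := by
  rw [rankOneUnipotent, map_add, map_one, vecMul_add, vecMul_one, RingHom.mapMatrix_apply,
    map_vecMulVec, vecMul_vecMulVec]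

theorem RowEquiv.of_rankOne (a b : ι → E) (h : b ⬝ᵥ a = 0) (hc : ∀ i j, a i * b j ∈ 𝔠) :
    RowEquiv π 𝔠 v (v + (v ⬝ᵥ (π ∘ a)) • (π ∘ b)) := by
  refine ⟨rankOneUnipotent a b h, ?_, vecMul_mapMatrix_rankOneUnipotent a b h⟩
  have : (Ideal.Quotient.mk 𝔠).mapMatrix (vecMulVec a b) = 0 := by
    ext i j
    exact Ideal.Quotient.eq_zero_iff_mem.2 (hc i j)
  rw [rankOneUnipotent, map_add, map_one, this, add_zero]

omit [Fintype ι] in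
theorem exists_lift_vec_eq_zero (hπ : Function.Surjective π) (i : ι) {c : ι → F} (hi : c i = 0) :
    ∃ b : ι → E, b i = 0 ∧ π ∘ b = c := by
  choose g hg using hπ
  refine ⟨Function.update (g ∘ c) i 0, by simp, ?_⟩
  ext j
  by_cases h : j = i
  · subst h; simp [hi]
  · simp [h, hg]

theorem RowEquiv.add_smul (hπ : Function.Surjective π) (i : ι) {c : ι → F} (hi : c i = 0)
    (hc : ∀ j, c j ∈ 𝔠.map π) : RowEquiv π 𝔠 v (v + v i • c) := by
  have hc' : ∀ j, ∃ b ∈ 𝔠, π b = c j := fun j => (Ideal.mem_map_iff_of_surjective π hπ).1 (hc j)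
  choose g hg1 hg2 using hc'
  have := RowEquiv.of_rankOne (π := π) (𝔠 := 𝔠) (v := v) (Pi.single i 1) (Function.update g i 0)
    (by simp) (fun k j => ?_)
  · convert this using 2
    congr 1
    · simp [dotProduct, Pi.single_apply, apply_ite π]
    · ext j
      by_cases h : j = i
      · subst h; simp [hi]
      · simp [h, hg2]
  · refine 𝔠.mul_mem_left _ ?_
    by_cases h : j = i
    · subst h; simp
    · simpa [h] using hg1 j

theorem RowEquiv.add_single (hπ : Function.Surjective π) (i : ι) {c : ι → F} (hi : c i = 0)
    (hc : ∀ j, c j ∈ 𝔠.map π) : RowEquiv π 𝔠 v (v + Pi.single i (v ⬝ᵥ c)) := by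
  have hc' : ∀ j, ∃ b ∈ 𝔠, π b = c j := fun j => (Ideal.mem_map_iff_of_surjective π hπ).1 (hc j)
  choose g hg1 hg2 using hc'
  have := RowEquiv.of_rankOne (π := π) (𝔠 := 𝔠) (v := v) (Function.update g i 0) (Pi.single i 1)
    (by simp) (fun j k => ?_)
  · convert this using 2
    have : π ∘ Function.update g i 0 = c := by
      ext j
      by_cases h : j = i
      · subst h; simp [hi]
      · simp [h, hg2]
    rw [this]
    ext j
    by_cases h : j = i
    · subst h; simp
    · simp [h]
  · refine 𝔠.mul_mem_right _ ?_
    by_cases h : j = i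
    · subst h; simp
    · simpa [h] using hg1 j

theorem RowEquiv.of_add_smul (hπ : Function.Surjective π) (i : ι) {c : ι → F} (hi : c i = 0)
    (h : RowEquiv π 𝔠 (v + v i • c) (v' + v' i • c)) : RowEquiv π 𝔠 v v' := by
  obtain ⟨b, hb, rfl⟩ := exists_lift_vec_eq_zero hπ i hi
  have hab : b ⬝ᵥ Pi.single i 1 = 0 := by simp [hb]
  refine RowEquiv.of_vecMul (rankOneUnipotent (Pi.single i 1) b hab) ?_
  rw [vecMul_mapMatrix_rankOneUnipotent, vecMul_mapMatrix_rankOneUnipotent]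
  have : π ∘ (Pi.single i 1 : ι → E) = Pi.single i 1 := by
    ext j; simp [Pi.single_apply, apply_ite π]
  simpa [this] using h

theorem RowEquiv.of_add_single (hπ : Function.Surjective π) (i : ι) {c : ι → F} (hi : c i = 0)
    (h : RowEquiv π 𝔠 (v + Pi.single i (v ⬝ᵥ c)) (v' + Pi.single i (v' ⬝ᵥ c))) :
    RowEquiv π 𝔠 v v' := by
  obtain ⟨b, hb, rfl⟩ := exists_lift_vec_eq_zero hπ i hi
  have hab : Pi.single i 1 ⬝ᵥ b = 0 := by simp [hb]
  refine RowEquiv.of_vecMul (rankOneUnipotent b (Pi.single i 1) hab) ?_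
  rw [vecMul_mapMatrix_rankOneUnipotent, vecMul_mapMatrix_rankOneUnipotent]
  have h1 : ∀ x : F, x • (π ∘ (Pi.single i 1 : ι → E)) = Pi.single i x := by
    intro x; ext j; simp [Pi.single_apply, apply_ite π]
  simpa only [h1] using h

theorem det_one_add_vecMulVec_add_vecMulVec (a b c d : ι → E) :
    det (1 + (vecMulVec a b + vecMulVec c d)) =
      (1 + b ⬝ᵥ a) * (1 + d ⬝ᵥ c) - (b ⬝ᵥ c) * (d ⬝ᵥ a) := by
  have : vecMulVec a b + vecMulVec c d = (Matrix.of ![a, c])ᵀ * Matrix.of ![b, d] := by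
    ext i j
    simp [Matrix.mul_apply, vecMulVec_apply]
  rw [this, det_one_add_mul_comm, det_fin_two]
  have key : ∀ k l : Fin 2, (Matrix.of ![b, d] * (Matrix.of ![a, c])ᵀ) k l =
      ![b, d] k ⬝ᵥ ![a, c] l := fun k l => rfl
  rw [Matrix.add_apply, Matrix.add_apply, Matrix.add_apply, Matrix.add_apply, key, key, key, key]
  simp

/-- If `v j = 1 - (1 + ζ * v i) * w'`, then multiplying `v i` by `1 + ζ * v i` does not change
the class of `v`. -/
theorem RowEquiv.update_mul {𝔱 𝓘 : Ideal E} (hπ : Function.Surjective π)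
    {i j : ι} (hij : i ≠ j)
    {ζ w' : F} (hζ : ζ ∈ 𝔱.map π) (hi : v i ∈ 𝓘.map π) (hj : v j ∈ 𝓘.map π)
    (hv : v j = 1 - (1 + ζ * v i) * w') :
    RowEquiv π (𝔱 * 𝓘) v (Function.update v i ((1 + ζ * v i) * v i)) := by
  obtain ⟨z, hz, rfl⟩ := (Ideal.mem_map_iff_of_surjective π hπ).1 hζ
  obtain ⟨p, hp, hpi⟩ := (Ideal.mem_map_iff_of_surjective π hπ).1 hi
  obtain ⟨q, hq, hqj⟩ := (Ideal.mem_map_iff_of_surjective π hπ).1 hj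
  obtain ⟨w, rfl⟩ := hπ w'
  obtain ⟨r, hr⟩ : ∃ r : E, r = 1 - (1 + z * p) * w := ⟨_, rfl⟩
  have hqr : π (q - r) = 0 := by
    rw [map_sub, hqj, hv, hr, ← hpi]; simp
  have hqr' : π r = v j := by rw [← hqj, eq_comm, ← sub_eq_zero, ← map_sub, hqr]
  let M : Matrix ι ι E := 1 + (vecMulVec (Pi.single i (z * w))
    (Pi.single i (p * (1 + z * p)) + Pi.single j r) +
      vecMulVec (Pi.single j (z * p)) (Pi.single i p - Pi.single j w))
  have hM : det M = 1 := by
    rw [det_one_add_vecMulVec_add_vecMulVec]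
    simp [hij, hij.symm]
    rw [hr]
    ring
  let T := rankOneUnipotent (Pi.single i (z * w)) (Pi.single j (q - r)) (by simp [hij])
  let U : (Matrix ι ι E)ˣ := M.nonsingInvUnit (by rw [hM]; exact isUnit_one)
  have hzp : Ideal.Quotient.mk (𝔱 * 𝓘) (z * p) = 0 :=
    Ideal.Quotient.eq_zero_iff_mem.2 (Ideal.mul_mem_mul hz hp)
  have hzq : Ideal.Quotient.mk (𝔱 * 𝓘) (z * q) = 0 :=
    Ideal.Quotient.eq_zero_iff_mem.2 (Ideal.mul_mem_mul hz hq)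
  refine ⟨T * U, ?_, ?_⟩
  · have hU : (Ideal.Quotient.mk (𝔱 * 𝓘)).mapMatrix (U : Matrix ι ι E) =
        (Ideal.Quotient.mk (𝔱 * 𝓘)).mapMatrix
          ((rankOneUnipotent (Pi.single i (z * w)) (Pi.single j (q - r)) (by simp [hij]))⁻¹ :
            (Matrix ι ι E)ˣ) := by
      have h1 : (U : Matrix ι ι E) = M := rfl
      have h2 : ((rankOneUnipotent (Pi.single i (z * w)) (Pi.single j (q - r)) (by simp [hij]))⁻¹ :
            (Matrix ι ι E)ˣ) = 1 - vecMulVec (Pi.single i (z * w)) (Pi.single j (q - r)) := rfl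
      rw [h1, h2]
      simp only [M, map_add, map_sub, map_one, RingHom.mapMatrix_apply, map_vecMulVec]
      have hs : ∀ (k : ι) (x : E), Ideal.Quotient.mk (𝔱 * 𝓘) ∘ (Pi.single k x : ι → E) =
          Pi.single k (Ideal.Quotient.mk (𝔱 * 𝓘) x) := by
        intro k x; ext l; simp [Pi.single_apply, apply_ite (Ideal.Quotient.mk (𝔱 * 𝓘))]
      have hs' : Ideal.Quotient.mk (𝔱 * 𝓘) ∘
          ((Pi.single i (p * (1 + z * p)) : ι → E) + Pi.single j r) =
          Pi.single i (Ideal.Quotient.mk (𝔱 * 𝓘) (p * (1 + z * p))) +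
            Pi.single j (Ideal.Quotient.mk (𝔱 * 𝓘) r) := by
        rw [← hs, ← hs]; ext k; simp
      have e1 : Ideal.Quotient.mk (𝔱 * 𝓘) (z * w) * Ideal.Quotient.mk (𝔱 * 𝓘) (p * (1 + z * p))
          = 0 := by
        rw [← map_mul, show z * w * (p * (1 + z * p)) = w * (1 + z * p) * (z * p) by ring, map_mul,
          hzp, mul_zero]
      have e2 : Ideal.Quotient.mk (𝔱 * 𝓘) (z * w) * Ideal.Quotient.mk (𝔱 * 𝓘) r =
          - (Ideal.Quotient.mk (𝔱 * 𝓘) (z * w) * Ideal.Quotient.mk (𝔱 * 𝓘) (q - r)) := by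
        rw [← map_mul, ← map_mul, ← map_neg, ← sub_eq_zero, ← map_sub,
          show z * w * r - -(z * w * (q - r)) = w * (z * q) by ring, map_mul, hzq, mul_zero]
      have hv2 : ∀ (k l : ι) (x y : E ⧸ (𝔱 * 𝓘)),
          vecMulVec (Pi.single k x) (Pi.single l y) = Matrix.single k l (x * y) := by
        intro k l x y
        ext k' l'
        simp only [vecMulVec_apply, Matrix.single_apply, Pi.single_apply]
        grind
      rw [hs', hs, hs, hs, hzp, Pi.single_zero, zero_vecMulVec, add_zero, vecMulVec_add,
        hv2, hv2, hv2, e1, e2, single_zero, zero_add, ← single_neg,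
        ← sub_eq_add_neg]
    rw [Units.val_mul, map_mul, hU, ← map_mul, Units.mul_inv, map_one]
  · have hT : v ᵥ* π.mapMatrix (T : Matrix ι ι E) = v := by
      rw [vecMul_mapMatrix_rankOneUnipotent]
      have : π ∘ (Pi.single j (q - r) : ι → E) = 0 := by
        ext k; simp [Pi.single_apply, apply_ite π, hqr, -map_sub]
      rw [this, smul_zero, add_zero]
    rw [Units.val_mul, map_mul, ← vecMul_vecMul, hT]
    have h1 : (U : Matrix ι ι E) = M := rfl
    rw [h1]
    simp only [M, map_add, map_one, RingHom.mapMatrix_apply, map_vecMulVec]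
    rw [vecMul_add, vecMul_one, vecMul_add, vecMul_vecMulVec, vecMul_vecMulVec]
    have hs : ∀ (k : ι) (x : E), π ∘ (Pi.single k x : ι → E) = Pi.single k (π x) := by
      intro k x; ext l; simp [Pi.single_apply, apply_ite π]
    rw [hs, hs, dotProduct_single, dotProduct_single]
    ext k
    by_cases hki : k = i
    · subst hki
      simp [hij, hpi]
      rw [hv]; ring
    · by_cases hkj : k = j
      · subst hkj
        simp [hki, hpi, hqr']
        ring
      · simp [hki, hkj]

end RowEquiv

section Chain

open Matrix

variable {ι E F : Type*} [CommRing E] [CommRing F]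

/-- Rows lifting the residue row `f` modulo `t * I ^ 2` whose common zeros away from `V(t)` lie
in `V(I)`; everything is tested only on primes containing `J`. -/
structure AdmissibleRow (J t I : Ideal F) (f v : ι → F) : Prop where
  sub_mem : ∀ k, v k - f k ∈ t * (I * I)
  le_of_mem : ∀ P : Ideal F, P.IsPrime → J ≤ P → ¬ t ≤ P → (∀ k, v k ∈ P) → I ≤ P

/-- A strictly increasing rank function on the primes containing `J` with the bounds required
to move rows of length `n` by general position. -/
structure IsPositionRank (J t : Ideal F) (n : ℕ) (ρ : Ideal F → ℕ) : Prop where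
  lt : ∀ P Q : Ideal F, P.IsPrime → Q.IsPrime → J ≤ P → P < Q → ρ P < ρ Q
  add_two_le : ∀ P : Ideal F, P.IsPrime → J ≤ P → ¬ t ≤ P → ρ P + 2 ≤ n
  one_le : ∀ P : Ideal F, P.IsPrime → J ≤ P → ∀ y ∈ t, 1 + y ∈ P → 1 ≤ ρ P
  le_maximal : ∀ M : Ideal F, M.IsMaximal → J ≤ M

theorem exists_sum_of_mem_mul_span_range {R : Type*} [CommRing R] [Fintype ι] {𝔞 : Ideal R}
    {v : ι → R} {x : R} (hx : x ∈ 𝔞 * Ideal.span (Set.range v)) :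
    ∃ m : ι → R, (∀ k, m k ∈ 𝔞) ∧ ∑ k, m k * v k = x := by
  rw [← smul_eq_mul, Ideal.span, Submodule.mem_ideal_smul_span_iff_exists_sum] at hx
  obtain ⟨a, ha, rfl⟩ := hx
  exact ⟨a, ha, by simp [Finsupp.sum_fintype]⟩

variable {π : E →+* F} {𝔱 𝓘 : Ideal E} {J t I : Ideal F} {f v v' : ι → F} {n : ℕ}
  {ρ : Ideal F → ℕ}

theorem AdmissibleRow.mem (hv : AdmissibleRow J t I f v) (hf : ∀ k, f k ∈ I) (k : ι) : v k ∈ I := by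
  have := I.add_mem ((Ideal.mul_le_right : (t * I) * I ≤ I)
    (by rw [mul_assoc]; exact hv.sub_mem k)) (hf k)
  simpa using this

theorem AdmissibleRow.of_sub_mem (hv : AdmissibleRow J t I f v)
    (h : ∀ k, v' k - v k ∈ t * (I * I))
    (h' : ∀ P : Ideal F, P.IsPrime → J ≤ P → ¬ t ≤ P → (∀ k, v' k ∈ P) → I ≤ P) :
    AdmissibleRow J t I f v' :=
  ⟨fun k => by simpa using Ideal.add_mem _ (h k) (hv.sub_mem k), h'⟩

theorem AdmissibleRow.span_range_eq [IsNoetherianRing F] (hv : AdmissibleRow J t I f v)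
    (hρ : IsPositionRank J t n ρ)
    (hf : ∀ k, f k ∈ I) (hfI : I ≤ Ideal.span (Set.range f) ⊔ t * (I * I)) :
    Ideal.span (Set.range v) = I := by
  have hsup : I ≤ Ideal.span (Set.range v) ⊔ t * (I * I) := by
    refine hfI.trans (sup_le (Ideal.span_le.2 ?_) le_sup_right)
    rintro _ ⟨k, rfl⟩
    have := Ideal.sub_mem (Ideal.span (Set.range v) ⊔ t * (I * I))
      (Ideal.mem_sup_left (Ideal.subset_span ⟨k, rfl⟩)) (Ideal.mem_sup_right (hv.sub_mem k))
    simpa using this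
  refine span_range_eq_of_forall_isMaximal (IsNoetherian.noetherian I) (hv.mem hf)
    (hsup.trans (sup_le_sup_left Ideal.mul_le_right _)) fun M hM hvM => ?_
  by_cases ht : t ≤ M
  · exact hsup.trans (sup_le (Ideal.span_le.2 (by rintro _ ⟨k, rfl⟩; exact hvM k))
      (Ideal.mul_le_left.trans ht))
  · exact hv.le_of_mem M hM.isPrime (hρ.le_maximal M hM) ht hvM

/-- Changing one entry of an admissible row, keeping it admissible, preserves the class. -/
theorem AdmissibleRow.rowEquiv_update [IsNoetherianRing F] [Fintype ι] [DecidableEq ι]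
    (hπ : Function.Surjective π) (hn : 2 ≤ Fintype.card ι)
    (hρ : IsPositionRank J (𝔱.map π) (Fintype.card ι) ρ)
    (hf : ∀ k, f k ∈ 𝓘.map π)
    (hfI : 𝓘.map π ≤ Ideal.span (Set.range f) ⊔ 𝔱.map π * (𝓘.map π * 𝓘.map π))
    (hv : AdmissibleRow J (𝔱.map π) (𝓘.map π) f v) (i : ι) (p' : F)
    (hv' : AdmissibleRow J (𝔱.map π) (𝓘.map π) f (Function.update v i p')) :
    RowEquiv π (𝔱 * 𝓘) v (Function.update v i p') := by
  obtain ⟨t, ht⟩ : ∃ t, t = 𝔱.map π := ⟨_, rfl⟩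
  obtain ⟨I, hI⟩ : ∃ I, I = 𝓘.map π := ⟨_, rfl⟩
  have htI : (𝔱 * 𝓘).map π = t * I := by rw [Ideal.map_mul, ht, hI]
  have hspan := hv.span_range_eq hρ hf hfI
  have hvI := hv.mem hf
  rw [← hI] at hspan hvI
  have hp : p' - v i ∈ t * I * Ideal.span (Set.range v) := by
    have := Ideal.sub_mem _ (hv'.sub_mem i) (hv.sub_mem i)
    rw [hspan, mul_assoc, ht, hI]
    simpa using this
  obtain ⟨m, hm, hmp⟩ := exists_sum_of_mem_mul_span_range hp
  have hmi := hm i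
  rw [← hspan] at hmi
  obtain ⟨z, hz, hzm⟩ := exists_sum_of_mem_mul_span_range hmi
  rw [hspan] at hmi
  obtain ⟨c, hc⟩ : ∃ c : ι → F, c = Function.update (fun k => m k + z k * v i) i 0 := ⟨_, rfl⟩
  have hci : c i = 0 := by simp [hc]
  have hctI : ∀ k, c k ∈ (𝔱 * 𝓘).map π := by
    intro k
    rw [htI]
    by_cases h : k = i
    · subst h; rw [hci]; exact Ideal.zero_mem _
    · simpa [hc, h] using Ideal.add_mem _ (hm k) (Ideal.mul_mem_mul (hz k) (hvI i))
  obtain ⟨w, hw⟩ : ∃ w, w = 1 + z i * v i := ⟨_, rfl⟩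
  have hdot : p' = w * v i + v ⬝ᵥ c := by
    have h1 : v ⬝ᵥ c = ∑ k, (m k * v k + v i * (z k * v k)) - (m i * v i + v i * (z i * v i)) := by
      rw [dotProduct, ← Finset.add_sum_erase _ _ (Finset.mem_univ i),
        ← Finset.add_sum_erase _ _ (Finset.mem_univ i), hci, mul_zero, zero_add, add_sub_cancel_left]
      refine Finset.sum_congr rfl fun k hk => ?_
      rw [hc, Function.update_of_ne (Finset.ne_of_mem_erase hk)]
      ring
    rw [Finset.sum_add_distrib, ← Finset.mul_sum, hmp, hzm] at h1
    rw [h1, hw]; ring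
  obtain ⟨u, hu⟩ : ∃ u, u = Function.update v i (w * v i) := ⟨_, rfl⟩
  have hui : u i = w * v i := by simp [hu]
  have hune : ∀ k, k ≠ i → u k = v k := fun k hk => by simp [hu, hk]
  have hdot' : ∀ a : ι → F, a i = 0 → u ⬝ᵥ a = v ⬝ᵥ a := by
    intro a ha
    refine Finset.sum_congr rfl fun k _ => ?_
    by_cases h : k = i
    · subst h; rw [ha, mul_zero, mul_zero]
    · rw [hune k h]
  have huv' : u + Pi.single i (u ⬝ᵥ c) = Function.update v i p' := by
    rw [hdot' c hci]
    ext k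
    by_cases h : k = i
    · subst h; simp [hui, hdot]
    · simp [h, hune k h]
  refine RowEquiv.trans ?_ (huv' ▸ RowEquiv.add_single hπ i hci hctI)
  have hztw : z i * v i ∈ t := Ideal.mul_mem_right _ _ (hz i)
  have hwt : ∀ P : Ideal F, P.IsPrime → w ∈ P → ¬ t ≤ P := by
    intro P hP hwP htP
    refine hP.ne_top ((Ideal.eq_top_iff_one _).2 ?_)
    simpa [hw] using P.sub_mem hwP (htP hztw)
  have hnv : ∀ M : Ideal F, M.IsMaximal → w ∈ M → ¬ ∀ k, k ≠ i → v k ∈ M := by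
    intro M hM hwM hk
    have hle : I ≤ M := by
      rw [hI]
      refine hv'.le_of_mem M hM.isPrime (hρ.le_maximal M hM) (ht ▸ hwt M hM.isPrime hwM) fun k => ?_
      by_cases h : k = i
      · subst h
        rw [Function.update_self, hdot]
        refine M.add_mem (M.mul_mem_right _ hwM) (M.sum_mem fun l _ => ?_)
        by_cases h : l = k
        · subst h; rw [hci, mul_zero]; exact M.zero_mem
        · exact M.mul_mem_right _ (hk l h)
      · rw [Function.update_of_ne h]; exact hk k h
    refine hM.ne_top ((Ideal.eq_top_iff_one _).2 ?_)
    simpa [hw] using M.sub_mem hwM (M.mul_mem_left (z i) (hle (hvI i)))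
  obtain ⟨j, hji⟩ : ∃ j, j ≠ i := by
    have : Nontrivial ι := Fintype.one_lt_card_iff_nontrivial.1 hn
    exact exists_ne i
  obtain ⟨T, hT⟩ : ∃ T : Finset ι, T = (Finset.univ.erase i).erase j := ⟨_, rfl⟩
  have hTc : T.card + 2 = Fintype.card ι := by
    rw [hT, Finset.card_erase_of_mem (Finset.mem_erase.2 ⟨hji, Finset.mem_univ j⟩),
      Finset.card_erase_of_mem (Finset.mem_univ i), Finset.card_univ]
    omega
  have hTm : ∀ k, k ∈ T ↔ k ≠ j ∧ k ≠ i := fun k => by simp [hT]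
  obtain ⟨e, he, he0, heP⟩ := exists_forall_mem_forall_isPrime_add_card_le (J := J)
    (W := Ideal.span {w}) (𝔟 := Ideal.span {v j}) hρ.lt (k := 1)
    (fun P hP hJP hwP _ => hρ.one_le P hP hJP _ (ht ▸ hztw)
      (hw ▸ hwP (Ideal.mem_span_singleton_self w))) v T
  have he' : ∀ k, ∃ x, x * v j = e k := fun k => Ideal.mem_span_singleton'.1 (he k)
  choose x hx using he'
  obtain ⟨b, hb⟩ : ∃ b : ι → F, b = fun k => if k ∈ T then x k else 0 := ⟨_, rfl⟩
  have hbi : b i = 0 := by simp [hb, hTm]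
  have hbj : b j = 0 := by simp [hb, hTm]
  have hbe : ∀ k ∈ T, b k * v j = e k := fun k hk => by simp [hb, hk, hx]
  have htop : Ideal.span {w} ⊔ Ideal.span (Set.range fun k : T => v k + v j * b k) = ⊤ := by
    by_contra hne
    obtain ⟨M, hM, hle⟩ := Ideal.exists_le_maximal _ hne
    have hwM : w ∈ M := hle (Ideal.mem_sup_left (Ideal.mem_span_singleton_self w))
    have hk : ∀ k ∈ T, v k + v j * b k ∈ M := fun k hk =>
      hle (Ideal.mem_sup_right (Ideal.subset_span ⟨⟨k, hk⟩, rfl⟩))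
    have hvj : v j ∉ M := by
      intro hvj
      refine hnv M hM hwM fun k hki => ?_
      by_cases hkj : k = j
      · exact hkj ▸ hvj
      · exact (Ideal.add_mem_iff_left _ (M.mul_mem_right _ hvj)).1 (hk k ((hTm k).2 ⟨hkj, hki⟩))
    have h1 := heP M hM.isPrime (hρ.le_maximal M hM)
      ((Ideal.span_singleton_le_iff_mem M).2 hwM)
      (fun k hkT => by rw [← hbe k hkT, mul_comm]; exact hk k hkT)
      (fun h => hvj ((Ideal.span_singleton_le_iff_mem M).1 h))
    have h2 := hρ.add_two_le M hM.isPrime (hρ.le_maximal M hM) (ht ▸ hwt M hM.isPrime hwM)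
    omega
  obtain ⟨r, hr, s, hs, hrs⟩ := Submodule.mem_sup.1 ((Ideal.eq_top_iff_one _).1 htop)
  obtain ⟨y, rfl⟩ := Ideal.mem_span_singleton'.1 hr
  obtain ⟨g, rfl⟩ := (Ideal.mem_span_range_iff_exists_fun).1 hs
  refine RowEquiv.of_add_smul hπ j hbj ?_
  obtain ⟨a, ha⟩ : ∃ a : ι → F, a = fun k => if h : k ∈ T then (1 - v j) * g ⟨k, h⟩ else 0 :=
    ⟨_, rfl⟩
  have hai : a i = 0 := by simp [ha, hTm]
  have haj : a j = 0 := by simp [ha, hTm]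
  refine RowEquiv.of_add_single hπ j haj ?_
  have hsum : (v + v j • b) ⬝ᵥ a = (1 - v j) * (1 - y * w) := by
    rw [eq_sub_of_add_eq' hrs |>.symm, Finset.mul_sum, dotProduct]
    rw [← Finset.sum_subset (Finset.subset_univ T) (fun k _ hk => by simp [ha, hk]),
      ← Finset.sum_attach T]
    refine Finset.sum_congr rfl fun k _ => ?_
    simp [ha]
    ring
  have hdot2 : (u + u j • b) ⬝ᵥ a = (v + v j • b) ⬝ᵥ a := by
    rw [add_dotProduct, add_dotProduct, hdot' a hai, hune j hji]
  obtain ⟨q, hq⟩ : ∃ q, q = v + v j • b + Pi.single j ((v + v j • b) ⬝ᵥ a) := ⟨_, rfl⟩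
  have hqi : q i = v i := by simp [hq, hbi, hji.symm]
  have hqj : q j = 1 - (1 + z i * q i) * (y * (1 - v j)) := by
    rw [hqi, ← hw, hq, hsum]
    simp [hbj]
    ring
  have hqu : u + u j • b + Pi.single j ((u + u j • b) ⬝ᵥ a) =
      Function.update q i ((1 + z i * q i) * q i) := by
    rw [hdot2, hune j hji]
    ext k
    by_cases h : k = i
    · subst h; simp [hbi, hji.symm, hqi, hui, hw]
    · simp [h, hune k h, hq]
  rw [← hq, hqu]
  refine RowEquiv.update_mul hπ hji.symm (ht ▸ hz i) (by rw [hqi, ← hI]; exact hvI i) ?_ hqj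
  rw [hq, ← hI]
  simp only [Pi.add_apply, Pi.smul_apply, hbj, smul_zero, add_zero, Pi.single_eq_same]
  refine I.add_mem (hvI j) (I.sum_mem fun k _ => I.mul_mem_right _ (I.add_mem (hvI k) ?_))
  exact I.mul_mem_right _ (hvI j)

theorem exists_rowEquiv_forall_ne [IsNoetherianRing F] {f v : Fin n → F}
    (hπ : Function.Surjective π) (hρ : IsPositionRank J (𝔱.map π) n ρ)
    (hv : AdmissibleRow J (𝔱.map π) (𝓘.map π) f v) (hvI : ∀ k, v k ∈ 𝓘.map π) (i : Fin n)
    (hpre : ∀ P : Ideal F, P.IsPrime → J ≤ P → ¬ 𝔱.map π * 𝓘.map π ≤ P → (∀ k < i, v k ∈ P) →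
      (i : ℕ) ≤ ρ P) :
    ∃ v' : Fin n → F, RowEquiv π (𝔱 * 𝓘) v v' ∧ (∀ k ≤ i, v' k = v k) ∧
      AdmissibleRow J (𝔱.map π) (𝓘.map π) f v' ∧
      ∀ P : Ideal F, P.IsPrime → J ≤ P → ¬ 𝔱.map π ≤ P → (∀ k, k ≠ i → v' k ∈ P) →
        𝓘.map π ≤ P := by
  obtain ⟨e, he, he0, heP⟩ := exists_forall_mem_forall_isPrime_add_card_le (J := J)
    (W := Ideal.span (v '' Set.Iio i)) (𝔟 := 𝔱.map π * 𝓘.map π * Ideal.span {v i}) hρ.lt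
    (k := (i : ℕ)) (fun P hP hJP hWP hbP => hpre P hP hJP (fun h => hbP (Ideal.mul_le_left.trans h))
      (fun k hk => hWP (Ideal.subset_span ⟨k, hk, rfl⟩))) v (Finset.Ioi i)
  have he' : ∀ k, ∃ x ∈ 𝔱.map π * 𝓘.map π, x * v i = e k := fun k =>
    Ideal.mem_mul_span_singleton.1 (he k)
  choose x hxI hx using he'
  obtain ⟨c, hc⟩ : ∃ c : Fin n → F, c = fun k => if i < k then x k else 0 := ⟨_, rfl⟩
  have hci : c i = 0 := by simp [hc]
  have hcI : ∀ k, c k ∈ (𝔱 * 𝓘).map π := by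
    intro k
    rw [Ideal.map_mul]
    by_cases h : i < k
    · simpa [hc, h] using hxI k
    · simp [hc, h]
  have hce : ∀ k, v i * c k = e k := by
    intro k
    by_cases h : i < k
    · rw [← hx k, mul_comm]; simp [hc, h]
    · rw [he0 k (by simpa using h)]; simp [hc, h]
  have hnv : ∀ P : Ideal F, P.IsPrime → J ≤ P → ¬ 𝔱.map π ≤ P →
      (∀ k, k ≠ i → (v + v i • c) k ∈ P) → 𝓘.map π ≤ P := by
    intro P hP hJP htP hk
    by_contra hIP
    by_cases hvi : v i ∈ P
    · refine hIP (hv.le_of_mem P hP hJP htP fun k => ?_)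
      by_cases hki : k = i
      · exact hki ▸ hvi
      · exact (Ideal.add_mem_iff_left _ (P.mul_mem_right _ hvi)).1 (hk k hki)
    · have h1 := heP P hP hJP (Ideal.span_le.2 ?_) (fun k hk' => ?_) ?_
      · have h2 := hρ.add_two_le P hP hJP htP
        rw [Fin.card_Ioi] at h1
        omega
      · rintro _ ⟨k, hki, rfl⟩
        have := hk k (ne_of_lt hki)
        rwa [Pi.add_apply, Pi.smul_apply, smul_eq_mul, hce, he0 k (by simpa using le_of_lt hki),
          add_zero] at this
      · have := hk k (ne_of_gt (Finset.mem_Ioi.1 hk'))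
        rwa [Pi.add_apply, Pi.smul_apply, smul_eq_mul, hce] at this
      · intro h
        rcases hP.mul_le.1 h with h | h
        · rcases hP.mul_le.1 h with h | h
          · exact htP h
          · exact hIP h
        · exact hvi (h (Ideal.mem_span_singleton_self _))
  refine ⟨v + v i • c, RowEquiv.add_smul hπ i hci hcI, fun k hk => ?_, hv.of_sub_mem (fun k => ?_)
    fun P hP hJP htP hk => hnv P hP hJP htP fun k _ => hk k, hnv⟩
  · simp [hc, not_lt.2 hk]
  · have := Ideal.mul_mem_mul (hcI k) (hvI i)
    rw [Ideal.map_mul, mul_assoc] at this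
    simpa [mul_comm] using this

/-- Two admissible rows are equivalent. -/
theorem AdmissibleRow.rowEquiv [IsNoetherianRing F] {f v v' : Fin n → F} (hn : 2 ≤ n)
    (hπ : Function.Surjective π) (hρ : IsPositionRank J (𝔱.map π) n ρ)
    (hf : ∀ k, f k ∈ 𝓘.map π)
    (hfI : 𝓘.map π ≤ Ideal.span (Set.range f) ⊔ 𝔱.map π * (𝓘.map π * 𝓘.map π))
    (hv : AdmissibleRow J (𝔱.map π) (𝓘.map π) f v)
    (hv' : AdmissibleRow J (𝔱.map π) (𝓘.map π) f v') :
    RowEquiv π (𝔱 * 𝓘) v v' := by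
  suffices H : ∀ l m : ℕ, m + l = n → ∀ v v' : Fin n → F,
      AdmissibleRow J (𝔱.map π) (𝓘.map π) f v → AdmissibleRow J (𝔱.map π) (𝓘.map π) f v' →
      (∀ k : Fin n, (k : ℕ) < m → v k = v' k) →
      (∀ P : Ideal F, P.IsPrime → J ≤ P → ¬ 𝔱.map π * 𝓘.map π ≤ P →
        (∀ k : Fin n, (k : ℕ) < m → v k ∈ P) → m ≤ ρ P) → RowEquiv π (𝔱 * 𝓘) v v' from
    H n 0 (zero_add n) v v' hv hv' (fun k hk => absurd hk (Nat.not_lt_zero _))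
      (fun _ _ _ _ _ => Nat.zero_le _)
  clear hv hv' v v'
  intro l
  induction l with
  | zero =>
    intro m hm v v' _ _ hvv' _
    have : v = v' := funext fun k => hvv' k (by rw [add_zero] at hm; exact hm ▸ k.2)
    exact this ▸ RowEquiv.refl v
  | succ l ih =>
    intro m hm v v' hv hv' hvv' hpre
    have hmn : m < n := by omega
    obtain ⟨i, hi⟩ : ∃ i : Fin n, (i : ℕ) = m := ⟨⟨m, hmn⟩, rfl⟩
    have hlt : ∀ k : Fin n, k < i ↔ (k : ℕ) < m := fun k => by rw [← hi]; rfl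
    have hpre' : ∀ P : Ideal F, P.IsPrime → J ≤ P → ¬ 𝔱.map π * 𝓘.map π ≤ P →
        (∀ k < i, v k ∈ P) → (i : ℕ) ≤ ρ P := fun P hP hJP htP hk =>
      hi ▸ hpre P hP hJP htP fun k hkm => hk k ((hlt k).2 hkm)
    obtain ⟨v₁, hvv₁, hv₁, hv₁a, hv₁n⟩ :=
      exists_rowEquiv_forall_ne hπ hρ hv (hv.mem hf) i hpre'
    obtain ⟨v₁', hvv₁', hv₁', hv₁a', hv₁n'⟩ :=
      exists_rowEquiv_forall_ne hπ hρ hv' (hv'.mem hf) i fun P hP hJP htP hk =>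
        hpre' P hP hJP htP fun k hki => hvv' k ((hlt k).1 hki) ▸ hk k hki
    obtain ⟨e, he, heP⟩ := exists_mem_forall_isPrime_succ_le (J := J)
      (W := Ideal.span (v '' Set.Iio i)) (𝔟 := 𝔱.map π * (𝓘.map π * 𝓘.map π)) hρ.lt (k := m)
      (fun P hP hJP hWP hbP => hi ▸ hpre' P hP hJP
        (fun h => hbP (by rw [← mul_assoc]; exact Ideal.mul_le_left.trans h))
        (fun k hk => hWP (Ideal.subset_span ⟨k, hk, rfl⟩))) (v i)
    have key : ∀ u : Fin n → F, AdmissibleRow J (𝔱.map π) (𝓘.map π) f u →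
        (∀ P : Ideal F, P.IsPrime → J ≤ P → ¬ 𝔱.map π ≤ P → (∀ k, k ≠ i → u k ∈ P) →
          𝓘.map π ≤ P) →
        AdmissibleRow J (𝔱.map π) (𝓘.map π) f (Function.update u i (v i + e)) := by
      intro u hu hun
      refine ⟨fun k => ?_, fun P hP hJP htP hk => hun P hP hJP htP fun k hki => ?_⟩
      · by_cases h : k = i
        · subst h
          rw [Function.update_self, add_sub_right_comm]
          exact Ideal.add_mem _ (hv.sub_mem k) he
        · rw [Function.update_of_ne h]; exact hu.sub_mem k
      · simpa [hki] using hk k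
    have hw := key v₁ hv₁a hv₁n
    have hw' := key v₁' hv₁a' hv₁n'
    have hcard : 2 ≤ Fintype.card (Fin n) := by simpa using hn
    have hρ' : IsPositionRank J (𝔱.map π) (Fintype.card (Fin n)) ρ := by simpa using hρ
    have hlt' : ∀ k : Fin n, (k : ℕ) < m → k ≠ i ∧ k ≤ i := fun k hk =>
      ⟨ne_of_lt ((hlt k).2 hk), le_of_lt ((hlt k).2 hk)⟩
    refine (hvv₁.trans (hv₁a.rowEquiv_update hπ hcard hρ' hf hfI i _ hw)).trans
      (RowEquiv.trans ?_
        (hvv₁'.trans (hv₁a'.rowEquiv_update hπ hcard hρ' hf hfI i _ hw')).symm)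
    refine ih (m + 1) (by omega) _ _ hw hw' (fun k hk => ?_) fun P hP hJP htP hk => ?_
    · by_cases h : k = i
      · subst h; rw [Function.update_self, Function.update_self]
      · have hkm : (k : ℕ) < m := lt_of_le_of_ne (Nat.lt_succ_iff.1 hk)
          fun h' => h (Fin.ext (h'.trans hi.symm))
        rw [Function.update_of_ne h, Function.update_of_ne h, hv₁ k (hlt' k hkm).2,
          hv₁' k (hlt' k hkm).2, hvv' k hkm]
    · refine heP P hP hJP (Ideal.span_le.2 ?_) ?_ ?_
      · rintro _ ⟨k, hki, rfl⟩
        have hkm := (hlt k).1 hki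
        have := hk k (by omega)
        rwa [Function.update_of_ne (hlt' k hkm).1, hv₁ k (hlt' k hkm).2] at this
      · simpa using hk i (by omega)
      · intro h
        rcases hP.mul_le.1 h with h | h
        · exact htP (Ideal.mul_le_left.trans h)
        · rcases hP.mul_le.1 h with h | h <;> exact htP (Ideal.mul_le_right.trans h)

end Chain

section Denominators

theorem exists_mul_mem_of_forall_mem_map {S R ι : Type*} [CommRing S] [CommRing R] [Algebra S R]
    [Finite ι] (M : Submonoid S) [IsLocalization M R] {I : Ideal S} {z : ι → R}
    (hz : ∀ k, z k ∈ I.map (algebraMap S R)) :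
    ∃ m ∈ M, ∀ k, ∃ ν ∈ I, algebraMap S R m * z k = algebraMap S R ν := by
  classical
  have := Fintype.ofFinite ι
  have h : ∀ k, ∃ m ∈ M, ∃ ν ∈ I, algebraMap S R m * z k = algebraMap S R ν := by
    intro k
    obtain ⟨⟨ν, m⟩, h⟩ := (IsLocalization.mem_map_algebraMap_iff M R).1 (hz k)
    exact ⟨m, m.2, ν, ν.2, by rw [mul_comm]; exact h⟩
  choose m hm ν hν h using h
  refine ⟨∏ k, m k, Submonoid.prod_mem _ fun k _ => hm k, fun k => ?_⟩
  obtain ⟨c, hc⟩ := Finset.dvd_prod_of_mem m (Finset.mem_univ k)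
  exact ⟨c * ν k, I.mul_mem_left _ (hν k), by
    rw [hc, mul_comm (m k), map_mul, mul_assoc, h, ← map_mul]⟩

theorem exists_mul_mem_of_map_le_map {S R : Type*} [CommRing S] [CommRing R] [Algebra S R]
    (M : Submonoid S) [IsLocalization M R] {I K : Ideal S} (hI : I.FG)
    (h : I.map (algebraMap S R) ≤ K.map (algebraMap S R)) :
    ∃ m ∈ M, ∀ p ∈ I, m * p ∈ K := by
  obtain ⟨s, rfl⟩ := hI
  obtain ⟨m, hm, H⟩ := exists_mul_mem_of_forall_mem_map (S := S) (R := R) M (I := K)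
    (z := fun k : s => algebraMap S R k)
    fun k => h (Ideal.mem_map_of_mem _ (Ideal.subset_span k.2))
  have H' : ∀ k : s, ∃ m' ∈ M, m' * k ∈ K := by
    intro k
    obtain ⟨ν, hν, h1⟩ := H k
    rw [← map_mul, IsLocalization.eq_iff_exists M] at h1
    obtain ⟨c, hc⟩ := h1
    exact ⟨c * m, M.mul_mem c.2 hm, by rw [mul_assoc, hc]; exact K.mul_mem_left _ hν⟩
  choose m' hm' hk using H'
  refine ⟨∏ k, m' k, Submonoid.prod_mem _ fun k _ => hm' k, fun p hp => ?_⟩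
  have : Ideal.span (s : Set S) ≤ Submodule.comap (LinearMap.mulLeft S (∏ k, m' k)) K := by
    refine Ideal.span_le.2 fun x hx => ?_
    obtain ⟨c, hc⟩ := Finset.dvd_prod_of_mem m' (Finset.mem_univ (⟨x, hx⟩ : s))
    change (∏ k, m' k) * x ∈ K
    rw [hc, mul_comm (m' _), mul_assoc]
    exact K.mul_mem_left _ (hk ⟨x, hx⟩)
  exact this hp

theorem exists_rescaled_row {D R ι : Type*} [CommRing D] [CommRing R] [Algebra D[X] R] [Finite ι]
    (M : Submonoid D) [IsLocalization (M.map (C : D →+* D[X])) R] {I : Ideal D[X]} (hI : I.FG)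
    {g : ι → D[X]} {W : ι → R}
    (hW : ∀ k, W k - algebraMap D[X] R (g k) ∈
      (Ideal.span {X} * (I * I)).map (algebraMap D[X] R))
    (hspan : I.map (algebraMap D[X] R) ≤ Ideal.span (Set.range W))
    (hg : ∀ P : Ideal D, P.IsPrime → (∀ k, eval 0 (g k) ∈ P) → ∀ p ∈ I, eval 0 p ∈ P) :
    ∃ h ∈ M, ∃ W' : ι → D[X],
      (∀ k, W' k - aeval (C (h ^ 2) * X : D[X]) (g k) ∈ Ideal.span {X} *
        (I.map (aeval (C (h ^ 2) * X : D[X])) * I.map (aeval (C (h ^ 2) * X : D[X])))) ∧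
      ∀ P : Ideal D[X], P.IsPrime → (∀ k, W' k ∈ P) → I.map (aeval (C (h ^ 2) * X : D[X])) ≤ P := by
  obtain ⟨_, ⟨h₁, hh₁, rfl⟩, H⟩ := exists_mul_mem_of_forall_mem_map (M.map (C : D →+* D[X])) hW
  have H' : ∀ k, ∃ ν ∈ I * I, algebraMap D[X] R (C h₁) * (W k - algebraMap D[X] R (g k)) =
      algebraMap D[X] R (X * ν) := by
    intro k
    obtain ⟨ν, hν, h⟩ := H k
    obtain ⟨z, hz, rfl⟩ := Ideal.mem_span_singleton_mul.1 hν
    exact ⟨z, hz, h⟩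
  choose ν hν hνW using H'
  have hspan' : I.map (algebraMap D[X] R) ≤
      (Ideal.span (Set.range fun k => C h₁ * g k + X * ν k)).map (algebraMap D[X] R) := by
    refine hspan.trans (Ideal.span_le.2 ?_)
    rintro _ ⟨k, rfl⟩
    have hu : IsUnit (algebraMap D[X] R (C h₁)) :=
      IsLocalization.map_units R (⟨C h₁, h₁, hh₁, rfl⟩ : M.map (C : D →+* D[X]))
    rw [SetLike.mem_coe, ← Ideal.unit_mul_mem_iff_mem _ hu]
    have : algebraMap D[X] R (C h₁) * W k = algebraMap D[X] R (C h₁ * g k + X * ν k) := by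
      rw [map_add, ← hνW, map_mul]; ring
    rw [this]
    exact Ideal.mem_map_of_mem _ (Ideal.subset_span ⟨k, rfl⟩)
  obtain ⟨_, ⟨h₂, hh₂, rfl⟩, H₂⟩ :=
    exists_mul_mem_of_map_le_map (M.map (C : D →+* D[X])) hI hspan'
  obtain ⟨h, hh⟩ : ∃ h, h = h₁ * h₂ := ⟨_, rfl⟩
  refine ⟨h, hh ▸ M.mul_mem hh₁ hh₂, ?_⟩
  obtain ⟨σ, hσ⟩ : ∃ σ : D[X] →ₐ[D] D[X], σ = aeval (C (h ^ 2) * X : D[X]) := ⟨_, rfl⟩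
  rw [← hσ]
  have hσX : σ X = C (h ^ 2) * X := by rw [hσ, aeval_X]
  have hσC : ∀ a, σ (C a) = C a := fun a => by rw [hσ, aeval_C]; rfl
  have hσ0 : ∀ p, ∃ q, σ p = C (eval 0 p) + C (h ^ 2) * q := by
    intro p
    obtain ⟨q, hq⟩ := X_dvd_sub_C (p := p)
    refine ⟨X * σ q, ?_⟩
    rw [← mul_assoc, ← hσX, ← map_mul, ← hq, map_sub, hσC, coeff_zero_eq_eval_zero]; ring
  refine ⟨fun k => σ (g k) + C h * X * σ (C h₂ * ν k), fun k => ?_, fun P hP hW' => ?_⟩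
  · rw [add_sub_cancel_left, mul_comm (C h), mul_assoc]
    refine Ideal.mul_mem_mul (Ideal.mem_span_singleton_self _) (Ideal.mul_mem_left _ _ ?_)
    rw [← Ideal.map_mul]
    exact Ideal.mem_map_of_mem _ (Ideal.mul_mem_left _ _ (hν k))
  · refine Ideal.map_le_iff_le_comap.2 fun p hp => ?_
    rw [Ideal.mem_comap]
    by_cases hhP : C h ∈ P
    · have hred : ∀ p, σ p ∈ P ↔ C (eval 0 p) ∈ P := by
        intro p
        obtain ⟨q, hq⟩ := hσ0 p
        rw [hq, P.add_mem_iff_left]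
        rw [map_pow, pow_two, mul_assoc]
        exact P.mul_mem_right _ hhP
      rw [hred]
      refine hg (P.comap C) (hP.comap C) (fun k => ?_) p hp
      rw [Ideal.mem_comap, ← hred]
      have := hW' k
      rwa [P.add_mem_iff_left] at this
      rw [mul_assoc]
      exact P.mul_mem_right _ hhP
    · have hh₂P : C h₂ ∉ P := fun h' => hhP (by rw [hh, map_mul]; exact P.mul_mem_left _ h')
      have hle : Ideal.span (Set.range fun k => C h₁ * g k + X * ν k) ≤ P.comap σ := by
        refine Ideal.span_le.2 ?_
        rintro _ ⟨k, rfl⟩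
        refine (hP.mem_or_mem (x := C h₂) ?_).resolve_left hh₂P
        have : C h₂ * σ (C h₁ * g k + X * ν k) =
            C h * (σ (g k) + C h * X * σ (C h₂ * ν k)) := by
          simp only [map_add, map_mul, hσX, hσC, hh, map_pow]; ring
        rw [this]
        exact P.mul_mem_left _ (hW' k)
      have := hle (H₂ p hp)
      rw [Ideal.mem_comap, map_mul, hσC] at this
      exact (hP.mem_or_mem this).resolve_left hh₂P

end Denominators

section Height

theorem height_le_height_comap_C_add_one {B : Type*} [CommRing B] [IsNoetherianRing B]
    (P : Ideal B[X]) [P.IsPrime] : P.height ≤ (P.comap C).height + 1 := by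
  obtain ⟨p, hp⟩ : ∃ p, p = P.comap (C : B →+* B[X]) := ⟨_, rfl⟩
  rw [← hp]
  have : p.IsPrime := hp ▸ inferInstance
  have : P.LiesOver p := ⟨hp⟩
  let Bₚ := Localization.AtPrime p
  let _ : Algebra B[X] Bₚ[X] := Polynomial.algebra B Bₚ
  have : IsLocalization (p.primeCompl.map (C : B →+* B[X])) Bₚ[X] :=
    Polynomial.isLocalization p.primeCompl Bₚ
  have hmap : p.map (algebraMap B Bₚ) = IsLocalRing.maximalIdeal Bₚ :=
    Localization.AtPrime.map_eq_maximalIdeal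
  have disj : Disjoint (p.primeCompl.map C : Set B[X]) P := by
    refine Set.disjoint_left.mpr fun a ⟨b, hb⟩ ha ↦ hb.1 ?_
    rwa [hp, SetLike.mem_coe, Ideal.mem_comap, hb.2]
  let P' : Ideal Bₚ[X] := P.map (algebraMap B[X] Bₚ[X])
  have : P'.IsPrime :=
    IsLocalization.isPrime_of_isPrime_disjoint (p.primeCompl.map C) Bₚ[X] P inferInstance disj
  have eq2 : P.height = P'.height := by
    rw [IsLocalization.height_map_of_disjoint (Submonoid.map C <| p.primeCompl) _ disj]
  have eq1 : p.height = (p.map (algebraMap B Bₚ)).height := by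
    rw [IsLocalization.height_map_of_disjoint p.primeCompl]
    exact Disjoint.symm <| Set.disjoint_left.mpr fun _ a b ↦ b a
  obtain ⟨M, hM, hPM⟩ := P'.exists_le_maximal Ideal.IsPrime.ne_top'
  have : M.LiesOver (p.map (algebraMap B Bₚ)) := by
    refine ⟨Ideal.IsMaximal.eq_of_le (hmap ▸ IsLocalRing.maximalIdeal.isMaximal Bₚ)
      Ideal.IsPrime.ne_top' (Ideal.map_le_iff_le_comap.2 fun x hx => ?_)⟩
    have h1 : algebraMap B[X] Bₚ[X] (C x) ∈ M := hPM (Ideal.mem_map_of_mem _ (by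
      rw [hp] at hx; exact hx))
    have h2 : algebraMap B[X] Bₚ[X] (C x) = C (algebraMap B Bₚ x) := by
      change Polynomial.mapRingHom _ (C x) = _
      simp
    rw [h2] at h1
    exact h1
  rw [eq1, ← Polynomial.height_eq_height_add_one (p.map (algebraMap B Bₚ)) M, eq2]
  exact Ideal.height_mono hPM

theorem height_comap_C_le_height {B : Type*} [CommRing B] [IsNoetherianRing B]
    (P : Ideal B[X]) [P.IsPrime] : (P.comap C).height ≤ P.height := by
  obtain ⟨p, hp⟩ : ∃ p, p = P.comap (C : B →+* B[X]) := ⟨_, rfl⟩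
  rw [← hp]
  have : p.IsPrime := hp ▸ inferInstance
  have : P.LiesOver p := ⟨hp⟩
  exact (Ideal.height_eq_height_add_of_liesOver_of_hasGoingDown p P).symm ▸ le_self_add

theorem height_comap_C_add_one_le_height {B : Type*} [CommRing B] [IsNoetherianRing B]
    (P : Ideal B[X]) [P.IsPrime] {y : B[X]} (hy : y ∈ P) (hy' : y ∉ (P.comap C).map C) :
    (P.comap C).height + 1 ≤ P.height := by
  have hlt : (P.comap C).map (C : B →+* B[X]) < P :=
    lt_of_le_of_ne Ideal.map_comap_le fun h => hy' (h.symm ▸ hy)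
  have : ((P.comap C).map (C : B →+* B[X])).IsPrime := Ideal.isPrime_map_C_of_isPrime
  have h := height_comap_C_le_height ((P.comap C).map (C : B →+* B[X]))
  rw [le_antisymm (Ideal.comap_mono hlt.le) Ideal.le_comap_map] at h
  exact (add_le_add_left h 1).trans (Ideal.height_add_one_le_of_lt_of_isPrime hlt)

end Height

section Compare

theorem IsPositionRank.of_retract {E E' : Type*} [CommRing E] [CommRing E'] {J t : Ideal E}
    {n : ℕ} {σ : Ideal E → ℕ} (hσ : IsPositionRank J t n σ) (ψ : E →+* E') (θ : E' →+* E)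
    (hθψ : ∀ x, θ (ψ x) = x) (hnil : ∀ x, θ x = 0 → IsNilpotent x) {t' : Ideal E'}
    (ht' : t'.map θ ≤ t) : IsPositionRank (J.map ψ) t' n fun P => σ (P.comap ψ) := by
  have key : ∀ P : Ideal E', P.IsPrime → ∀ x, ψ (θ x) ∈ P ↔ x ∈ P := by
    intro P hP x
    have h : x - ψ (θ x) ∈ P := nilpotent_iff_mem_prime.1 (hnil (x - ψ (θ x)) (by simp [hθψ])) P hP
    rw [← P.add_mem_iff_right h, sub_add_cancel]
  refine ⟨fun P Q hP hQ hJP hPQ => ?_, fun P hP hJP htP => ?_, fun P hP hJP y hy h1 => ?_,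
    fun M hM => ?_⟩
  · refine hσ.lt _ _ (hP.comap ψ) (hQ.comap ψ) (Ideal.map_le_iff_le_comap.1 hJP)
      (lt_of_le_of_ne (Ideal.comap_mono hPQ.le) fun h => ?_)
    obtain ⟨x, hxQ, hxP⟩ := SetLike.exists_of_lt hPQ
    have : θ x ∈ Q.comap ψ := (key Q hQ x).2 hxQ
    exact hxP ((key P hP x).1 (h.symm ▸ this : θ x ∈ P.comap ψ))
  · exact hσ.add_two_le _ (hP.comap ψ) (Ideal.map_le_iff_le_comap.1 hJP)
      fun h => htP fun x hx => (key P hP x).1 (h (ht' (Ideal.mem_map_of_mem _ hx)))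
  · refine hσ.one_le _ (hP.comap ψ) (Ideal.map_le_iff_le_comap.1 hJP) (θ y)
      (ht' (Ideal.mem_map_of_mem _ hy)) ?_
    have := (key P hP _).2 h1
    rwa [map_add, map_one] at this
  · have hθ : Function.Surjective θ := fun x => ⟨ψ x, hθψ x⟩
    have hmem : ∀ x, x ∈ M.map θ → ψ x ∈ M := by
      intro x hx
      obtain ⟨m, hm, rfl⟩ := (Ideal.mem_map_iff_of_surjective θ hθ).1 hx
      exact (key M hM.isPrime m).2 hm
    rcases Ideal.map_eq_top_or_isMaximal_of_surjective θ hθ hM with h | h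
    · refine absurd ((Ideal.eq_top_iff_one M).2 ?_) hM.ne_top
      rw [← map_one ψ]
      exact hmem 1 (h ▸ Submodule.mem_top)
    · exact Ideal.map_le_iff_le_comap.2 fun x hx => hmem x (hσ.le_maximal _ h hx)

open Matrix in
theorem span_range_vecMul_le {R m l : Type*} [CommRing R] [Fintype m] (v : m → R)
    (M : Matrix m l R) : Ideal.span (Set.range (v ᵥ* M)) ≤ Ideal.span (Set.range v) := by
  refine Ideal.span_le.2 ?_
  rintro _ ⟨k, rfl⟩
  exact Ideal.sum_mem _ fun j _ => Ideal.mul_mem_right _ _ (Ideal.subset_span ⟨j, rfl⟩)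

open Matrix in
theorem exists_span_range_eq_sub_mem {E : Type*} [CommRing E] [IsNoetherianRing E] {n : ℕ}
    (hn : 2 ≤ n) {J t : Ideal E} {σ : Ideal E → ℕ} (hσ : IsPositionRank J t n σ)
    {I 𝔱 : Ideal E[X]} (h𝔱 : 𝔱.map (evalRingHom 0) ≤ t) {f G F : Fin n → E[X]}
    (hf : ∀ k, f k ∈ I) (hfI : I ≤ Ideal.span (Set.range f) ⊔ 𝔱 * (I * I))
    (hG : ∀ k, G k - f k ∈ 𝔱 * (I * I)) (hGI : Ideal.span (Set.range G) = I)
    (hF : ∀ k, F k - f k ∈ 𝔱 * (I * I))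
    (hFI : ∀ P : Ideal E, P.IsPrime → (∀ k, eval 0 (F k) ∈ P) → ∀ p ∈ I, eval 0 p ∈ P) :
    ∃ W : Fin n → E[X], Ideal.span (Set.range W) = I ∧
      ∀ k, W k - F k ∈ Ideal.span {X} * (I * I) := by
  obtain ⟨c₀, hc₀⟩ := Ideal.exists_pow_inf_eq_pow_smul (Ideal.span {(X : E[X])})
    (I * I : Ideal E[X])
  obtain ⟨c, hcdef⟩ : ∃ c, c = c₀ + 1 := ⟨_, rfl⟩
  have hc : ∀ p ∈ I * I, p ∈ Ideal.span {(X : E[X]) ^ c} → p ∈ Ideal.span {X} * (I * I) := by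
    intro p hp hpc
    have h : p ∈ Ideal.span {(X : E[X])} ^ c • (⊤ : Ideal E[X]) ⊓ (I * I) :=
      ⟨by rwa [smul_eq_mul, Ideal.mul_top, Ideal.span_singleton_pow], hp⟩
    rw [hc₀ c (by omega), hcdef, Nat.add_sub_cancel_left, pow_one, smul_eq_mul] at h
    exact Ideal.mul_mono_right inf_le_right h
  let π : E[X] →+* E[X] ⧸ Ideal.span {(X : E[X]) ^ c} := Ideal.Quotient.mk _
  have hπ : Function.Surjective π := Ideal.Quotient.mk_surjective
  let θ : E[X] ⧸ Ideal.span {(X : E[X]) ^ c} →+* E :=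
    Ideal.Quotient.lift _ (evalRingHom 0) fun a ha => by
      obtain ⟨b, rfl⟩ := Ideal.mem_span_singleton'.1 ha
      simp [hcdef]
  have hθπ : ∀ p, θ (π p) = eval 0 p := fun p => rfl
  have hXnil : IsNilpotent (π X) := ⟨c, by
    rw [← map_pow]
    exact Ideal.Quotient.eq_zero_iff_mem.2 (Ideal.mem_span_singleton_self _)⟩
  have hnil : ∀ x, θ x = 0 → IsNilpotent x := by
    intro x hx
    obtain ⟨p, rfl⟩ := hπ x
    rw [hθπ, ← coeff_zero_eq_eval_zero] at hx
    obtain ⟨q, rfl⟩ := X_dvd_iff.2 hx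
    rw [map_mul]
    exact (Commute.all _ _).isNilpotent_mul_right hXnil
  have hσ' := hσ.of_retract (π.comp C) θ (fun x => by simp [hθπ]) hnil (t' := 𝔱.map π) (by
    rw [Ideal.map_map]
    exact h𝔱)
  have hmap : (𝔱 * (I * I)).map π = 𝔱.map π * (I.map π * I.map π) := by
    rw [Ideal.map_mul, Ideal.map_mul]
  have hsub : ∀ {u : Fin n → E[X]}, (∀ k, u k - f k ∈ 𝔱 * (I * I)) → ∀ k,
      (π ∘ u) k - (π ∘ f) k ∈ 𝔱.map π * (I.map π * I.map π) := by
    intro u hu k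
    rw [← hmap, Function.comp, Function.comp, ← map_sub]
    exact Ideal.mem_map_of_mem _ (hu k)
  obtain ⟨Θ, hΘ, hΘ'⟩ := AdmissibleRow.rowEquiv (𝔱 := 𝔱) (𝓘 := I) (f := π ∘ f) (v := π ∘ G)
    (v' := π ∘ F) hn hπ hσ' (fun k => Ideal.mem_map_of_mem _ (hf k))
    (by
      rw [← hmap, Set.range_comp, ← Ideal.map_span, ← Ideal.map_sup]
      exact Ideal.map_mono hfI)
    ⟨hsub hG, fun P hP _ _ h => by
      rw [← hGI, Ideal.map_span, ← Set.range_comp]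
      exact Ideal.span_le.2 (Set.range_subset_iff.2 h)⟩
    ⟨hsub hF, fun P hP _ _ h => by
      have key : ∀ p, π p ∈ P ↔ π (C (eval 0 p)) ∈ P := by
        intro p
        have h0 : π p - π (C (eval 0 p)) ∈ P :=
          nilpotent_iff_mem_prime.1 (hnil _ (by rw [map_sub, hθπ, hθπ]; simp)) P hP
        rw [Iff.comm, ← P.add_mem_iff_right h0, sub_add_cancel]
      refine Ideal.map_le_iff_le_comap.2 fun p hp => ?_
      exact (key p).2 (hFI (P.comap (π.comp C)) (hP.comap _) (fun k => (key _).1 (h k)) p hp)⟩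
  refine ⟨G ᵥ* (Θ : Matrix (Fin n) (Fin n) E[X]), ?_, fun k => hc _ ?_ ?_⟩
  · rw [← hGI]
    refine le_antisymm (span_range_vecMul_le _ _) ?_
    have h := span_range_vecMul_le (G ᵥ* (Θ : Matrix (Fin n) (Fin n) E[X]))
      ((Θ⁻¹ : (Matrix (Fin n) (Fin n) E[X])ˣ) : Matrix (Fin n) (Fin n) E[X])
    rwa [vecMul_vecMul, Units.mul_inv, vecMul_one] at h
  · have hGm : ∀ k, G k ∈ I := fun k => hGI ▸ Ideal.subset_span ⟨k, rfl⟩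
    have h1 : ∀ i j, (Θ - 1 : Matrix (Fin n) (Fin n) E[X]) i j ∈ I := by
      intro i j
      refine (Ideal.mul_le_right : 𝔱 * I ≤ I) (Ideal.Quotient.eq_zero_iff_mem.1 ?_)
      have h : (Ideal.Quotient.mk (𝔱 * I)).mapMatrix (Θ - 1 : Matrix (Fin n) (Fin n) E[X]) = 0 := by
        rw [map_sub, hΘ, map_one, sub_self]
      exact congrFun (congrFun h i) j
    have h2 : (G ᵥ* (Θ : Matrix (Fin n) (Fin n) E[X])) k - G k ∈ I * I := by
      have : (G ᵥ* (Θ : Matrix (Fin n) (Fin n) E[X])) k - G k =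
          (G ᵥ* (Θ - 1 : Matrix (Fin n) (Fin n) E[X])) k := by
        rw [vecMul_sub, vecMul_one, Pi.sub_apply]
      rw [this]
      change ∑ j, G j * (Θ - 1 : Matrix (Fin n) (Fin n) E[X]) j k ∈ I * I
      exact Ideal.sum_mem _ fun j _ => Ideal.mul_mem_mul (hGm j) (h1 j k)
    have h3 := (I * I).sub_mem ((I * I).add_mem h2 ((Ideal.mul_le_right : 𝔱 * (I * I) ≤ I * I)
      (hG k))) ((Ideal.mul_le_right : 𝔱 * (I * I) ≤ I * I) (hF k))
    convert h3 using 1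
    ring
  · refine Ideal.Quotient.eq_zero_iff_mem.1 ?_
    change π _ = 0
    rw [map_sub, sub_eq_zero]
    refine Eq.trans ?_ (congrFun hΘ' k)
    simp [vecMul, dotProduct]

end Compare

section Position

/-- The polynomials congruent modulo `J ^ 2` to a constant congruent to `1` modulo `s`. -/
def nearConstantSubmonoid {B : Type*} [CommRing B] (J : Ideal B) (s : B) : Submonoid B[X] where
  carrier := {h | ∃ u : B, u - 1 ∈ Ideal.span {s} ∧ h - C u ∈ (J * J).map C}
  one_mem' := ⟨1, by simp, by simp⟩
  mul_mem' := by
    rintro h h' ⟨u, hu, hh⟩ ⟨u', hu', hh'⟩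
    refine ⟨u * u', ?_, ?_⟩
    · convert Ideal.add_mem _ (Ideal.mul_mem_right u' _ hu) hu' using 1
      ring
    · convert Ideal.add_mem _ (Ideal.mul_mem_right h' _ hh) (Ideal.mul_mem_left _ (C u) hh') using 1
      rw [C_mul]; ring

theorem mem_nearConstantSubmonoid {B : Type*} [CommRing B] {J : Ideal B} {s : B} {h : B[X]} :
    h ∈ nearConstantSubmonoid J s ↔
      ∃ u : B, u - 1 ∈ Ideal.span {s} ∧ h - C u ∈ (J * J).map C := Iff.rfl

theorem isPositionRank_nearConstant {B E : Type*} [CommRing B] [IsNoetherianRing B] [CommRing E]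
    [Algebra B[X] E] {J : Ideal B} {s : B} [IsLocalization (nearConstantSubmonoid J s) E]
    {d n : ℕ} (hdn : d + 3 ≤ 2 * n)
    (hd : ∀ q : Ideal B, q.IsPrime → q.height ≤ d)
    (hJ : ∀ q : Ideal B, q.IsPrime → J ≤ q → (n : ℕ∞) ≤ q.height + 1) :
    IsPositionRank ((J.map C).map (algebraMap B[X] E))
      (Ideal.span {algebraMap B[X] E (C s * X)}) n
      fun P => (P.comap (algebraMap B[X] E)).height.toNat - (n - 1) := by
  have hmem : ∀ P : Ideal E, P.IsPrime → ∀ u : B, u - 1 ∈ Ideal.span {s} →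
      u ∉ (P.comap (algebraMap B[X] E)).comap C := by
    intro P hP u hu h
    refine hP.ne_top (Ideal.eq_top_of_isUnit_mem _ h
      (IsLocalization.map_units E (⟨C u, u, hu, by simp⟩ : nearConstantSubmonoid J s)))
  have hJle : ∀ P : Ideal E, (J.map C).map (algebraMap B[X] E) ≤ P →
      J ≤ (P.comap (algebraMap B[X] E)).comap C := fun P h =>
    Ideal.map_le_iff_le_comap.1 (Ideal.map_le_iff_le_comap.1 h)
  have hfin : ∀ P : Ideal B[X], P.IsPrime → P.height ≠ ⊤ := by
    intro P hP h
    have h1 := (height_le_height_comap_C_add_one P).trans (add_le_add_left (hd _ (hP.comap C)) 1)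
    rw [h, top_le_iff] at h1
    exact absurd h1 (by exact_mod_cast ENat.natCast_ne_top (d + 1))
  refine ⟨fun P Q hP hQ hJP hPQ => ?_, fun P hP hJP htP => ?_, fun P hP hJP y hy h1 => ?_,
    fun M hM => ?_⟩
  · have hlt : P.comap (algebraMap B[X] E) < Q.comap (algebraMap B[X] E) := by
      refine lt_of_le_of_ne (Ideal.comap_mono hPQ.le) fun h => hPQ.ne ?_
      exact ((IsLocalization.map_under (nearConstantSubmonoid J s) E P).symm.trans
        (congrArg (Ideal.map (algebraMap B[X] E)) h)).trans
        (IsLocalization.map_under (nearConstantSubmonoid J s) E Q)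
    have hP' := hP.comap (algebraMap B[X] E)
    have hQ' := hQ.comap (algebraMap B[X] E)
    have h1 := Ideal.height_add_one_le_of_lt_of_isPrime hlt
    have h2 := (hJ _ (hP'.comap C) (hJle P hJP)).trans
      (add_le_add_left (height_comap_C_le_height _) 1)
    rw [← ENat.natCast_toNat (hfin _ hP')] at h1 h2
    rw [← ENat.natCast_toNat (hfin _ hQ')] at h1
    norm_cast at h1 h2
    omega
  · have hP' := hP.comap (algebraMap B[X] E)
    have hq := hP'.comap C
    have hs : s ∉ (P.comap (algebraMap B[X] E)).comap C := by
      intro h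
      refine htP ((Ideal.span_singleton_le_iff_mem _).2 ?_)
      rw [map_mul]
      exact P.mul_mem_right _ h
    have hne : (P.comap (algebraMap B[X] E)).comap C ⊔ Ideal.span {s} ≠ ⊤ := by
      intro h
      obtain ⟨a, ha, b, hb, hab⟩ := Submodule.mem_sup.1 ((Ideal.eq_top_iff_one _).1 h)
      refine hmem P hP a ?_ ha
      rw [← hab, sub_add_cancel_left]
      exact neg_mem hb
    obtain ⟨m, hm, hle⟩ := Ideal.exists_le_maximal _ hne
    have hlt : (P.comap (algebraMap B[X] E)).comap C < m :=
      lt_of_le_of_ne (le_sup_left.trans hle) fun h =>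
        hs (h ▸ hle (Ideal.mem_sup_right (Ideal.mem_span_singleton_self s)))
    have hmp := hm.isPrime
    have h1 := ((height_le_height_comap_C_add_one _).trans
      (Ideal.height_add_one_le_of_lt_of_isPrime hlt)).trans (hd m hmp)
    rw [← ENat.natCast_toNat (hfin _ hP')] at h1
    norm_cast at h1
    omega
  · have hP' := hP.comap (algebraMap B[X] E)
    have hq := hP'.comap C
    obtain ⟨a, rfl⟩ := Ideal.mem_span_singleton'.1 hy
    obtain ⟨a, ⟨h, hh⟩, rfl⟩ := IsLocalization.exists_mk'_eq (nearConstantSubmonoid J s) a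
    have h2 : h + a * (C s * X) ∈ P.comap (algebraMap B[X] E) := by
      rw [Ideal.mem_comap]
      convert P.mul_mem_left (algebraMap B[X] E h) h1 using 1
      have e := IsLocalization.mk'_spec' E a (⟨h, hh⟩ : nearConstantSubmonoid J s)
      rw [map_add, map_mul]
      linear_combination (-algebraMap B[X] E (C s * X)) * e
    obtain ⟨u, hu, hhu⟩ := mem_nearConstantSubmonoid.1 hh
    have h3 : h + a * (C s * X) ∉ ((P.comap (algebraMap B[X] E)).comap C).map C := by
      intro h3
      have h4 := Ideal.mem_map_C_iff.1 h3 0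
      have h5 := Ideal.mem_map_C_iff.1 hhu 0
      rw [coeff_sub, coeff_C_zero] at h5
      rw [← mul_assoc, coeff_add, coeff_mul_X_zero, add_zero] at h4
      refine hmem P hP u hu ?_
      have h6 := (hJle P hJP) ((Ideal.mul_le_left : J * J ≤ J) h5)
      simpa using Ideal.sub_mem _ h4 h6
    have h7 := (hJ _ hq (hJle P hJP)).trans (height_comap_C_add_one_le_height _ h2 h3)
    rw [← ENat.natCast_toNat (hfin _ hP')] at h7
    norm_cast at h7
    omega
  · refine Ideal.map_le_iff_le_comap.2 (Ideal.map_le_iff_le_comap.2 fun j hj => ?_)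
    change algebraMap B[X] E (C j) ∈ M
    by_contra hjM
    have hj2 : algebraMap B[X] E (C (j * j)) ∉ M := by
      rw [C_mul, map_mul]
      exact fun h => (hM.isPrime.mem_or_mem h).elim hjM hjM
    obtain ⟨x, y, hy, hxy⟩ := hM.exists_inv hj2
    obtain ⟨a, ⟨h, hh⟩, rfl⟩ := IsLocalization.exists_mk'_eq (nearConstantSubmonoid J s) x
    have hunit : IsUnit (algebraMap B[X] E (h - a * C (j * j))) := by
      refine IsLocalization.map_units E (⟨_, ?_⟩ : nearConstantSubmonoid J s)
      obtain ⟨u, hu, hhu⟩ := mem_nearConstantSubmonoid.1 hh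
      refine ⟨u, hu, ?_⟩
      rw [sub_right_comm]
      exact Ideal.sub_mem _ hhu (Ideal.mul_mem_left _ _
        (Ideal.mem_map_of_mem _ (Ideal.mul_mem_mul hj hj)))
    refine hM.ne_top (Ideal.eq_top_of_isUnit_mem _ ?_ hunit)
    convert M.mul_mem_left (algebraMap B[X] E h) hy using 1
    have e := IsLocalization.mk'_spec' E a (⟨h, hh⟩ : nearConstantSubmonoid J s)
    rw [map_sub, map_mul]
    linear_combination algebraMap B[X] E (C (j * j)) * e - algebraMap B[X] E h * hxy

end Position

section LiftAt

variable {ι B R S : Type*} [CommRing B] [CommRing R] [CommRing S] [Algebra B R] [Algebra B S]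

/-- The row `v` generates the specialization of `I` at `x` and lifts the specialization of `f`
modulo `t * I ^ 2`. -/
structure IsLiftAt (I : Ideal B[X]) (f : ι → B[X]) (x : R) (t : Ideal R) (v : ι → R) : Prop where
  sub_mem : ∀ k, v k - aeval x (f k) ∈ t * (I.map (aeval x) * I.map (aeval x))
  span_eq : Ideal.span (Set.range v) = I.map (aeval x)

theorem map_map_aeval (I : Ideal B[X]) (g : R →ₐ[B] S) (x : R) :
    (I.map (aeval x)).map g = I.map (aeval (g x)) := by
  rw [Ideal.map_mapₐ, aeval_algHom]

variable {I : Ideal B[X]} {f : ι → B[X]} {x : R} {t t' : Ideal R} {v : ι → R}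

theorem IsLiftAt.mono (h : IsLiftAt I f x t v) (htt' : t ≤ t') : IsLiftAt I f x t' v :=
  ⟨fun k => Ideal.mul_mono_left htt' (h.sub_mem k), h.span_eq⟩

theorem IsLiftAt.map (h : IsLiftAt I f x t v) (g : R →ₐ[B] S) :
    IsLiftAt I f (g x) (t.map g) (g ∘ v) := by
  refine ⟨fun k => ?_, ?_⟩
  · rw [← map_map_aeval, ← Ideal.map_mul, ← Ideal.map_mul, aeval_algHom_apply, Function.comp,
      ← map_sub]
    exact Ideal.mem_map_of_mem _ (h.sub_mem k)
  · rw [← map_map_aeval, Set.range_comp, ← Ideal.map_span, h.span_eq]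

theorem map_aeval_le_sup (hfI : I ≤ Ideal.span (Set.range f) ⊔ I * I * Ideal.span {X}) (x : R)
    (hx : x ∈ t) : I.map (aeval x) ≤ Ideal.span (Set.range fun k => aeval x (f k)) ⊔
      t * (I.map (aeval x) * I.map (aeval x)) := by
  refine (Ideal.map_mono hfI).trans ?_
  rw [Ideal.map_sup, Ideal.map_mul, Ideal.map_mul, Ideal.map_span, Ideal.map_span,
    Set.image_singleton, aeval_X, ← Set.range_comp, mul_comm]
  exact sup_le_sup_left (Ideal.mul_mono_left ((Ideal.span_singleton_le_iff_mem _).2 hx)) _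

theorem IsLiftAt.exists_of_isUnit {t : B} {v : ι → B[X]}
    (h : IsLiftAt I f (C t * X : B[X]) (Ideal.span {X}) v) (ht : IsUnit (algebraMap B R t)) (x : R) :
    ∃ v' : ι → R, IsLiftAt I f x (Ideal.span {x}) v' := by
  obtain ⟨t', ht'⟩ := ht.exists_right_inv
  have h' := h.map (aeval (t' * x) : B[X] →ₐ[B] R)
  rw [map_mul, aeval_C, aeval_X, ← mul_assoc, ht', one_mul, Ideal.map_span, Set.image_singleton,
    aeval_X] at h'
  exact ⟨_, h'.mono (Ideal.span_singleton_le_span_singleton.2 (dvd_mul_left _ _))⟩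

theorem IsLiftAt.exists_eval_zero_eq {τ : R} (h : IsLiftAt I f x (Ideal.span {τ}) v) {y : R[X]}
    (hy : eval 0 y = x) : ∃ g : ι → R[X],
      (∀ k, g k - aeval y (f k) ∈ Ideal.span {C τ} * (I.map (aeval y) * I.map (aeval y))) ∧
      (∀ k, eval 0 (g k) = v k) ∧
      ∀ P : Ideal R, (∀ k, v k ∈ P) → ∀ p ∈ I.map (aeval y), eval 0 p ∈ P := by
  let ev : R[X] →ₐ[B] R := (aeval (0 : R)).restrictScalars B
  have hev : ∀ p, ev p = eval 0 p := fun p => by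
    rw [← coe_aeval_eq_eval]; rfl
  have hevy : ev y = x := by rw [hev, hy]
  have hevI : (I.map (aeval y)).map ev = I.map (aeval x) := by rw [map_map_aeval, hevy]
  have hμ : ∀ k, ∃ μ ∈ Ideal.span {C τ} * (I.map (aeval y) * I.map (aeval y)),
      eval 0 μ = v k - aeval x (f k) := by
    intro k
    have h := h.sub_mem k
    rw [← hevI, ← Ideal.map_mul] at h
    have h' : (Ideal.span {C τ} : Ideal R[X]).map ev = Ideal.span {τ} := by
      rw [Ideal.map_span, Set.image_singleton, hev, eval_C]
    rw [← h', ← Ideal.map_mul] at h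
    obtain ⟨μ, hμ, h⟩ := (Ideal.mem_map_iff_of_surjective ev
      fun b => ⟨C b, by rw [hev, eval_C]⟩).1 h
    exact ⟨μ, hμ, by rw [← h, hev]⟩
  choose μ hμ hμ0 using hμ
  refine ⟨fun k => aeval y (f k) + μ k, fun k => ?_, fun k => ?_, fun P hP p hp => ?_⟩
  · rw [add_sub_cancel_left]
    exact hμ k
  · rw [eval_add, hμ0, ← hev, ← aeval_algHom_apply, hevy, add_sub_cancel]
  · have : I.map (aeval x) ≤ P := by
      rw [← h.span_eq]
      exact Ideal.span_le.2 (Set.range_subset_iff.2 hP)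
    refine this ?_
    rw [← hevI, ← hev]
    exact Ideal.mem_map_of_mem _ hp

theorem exists_bivariate_row [IsNoetherianRing B] {s : B} (E : Type*) [CommRing E] [Algebra B[X] E]
    [Algebra B E] [IsScalarTower B B[X] E]
    [IsLocalization (nearConstantSubmonoid (I.comap C) s) E] {d n : ℕ} (hdn : d + 3 ≤ 2 * n)
    {f vs vt : Fin n → B[X]} (hf : ∀ k, f k ∈ I)
    (hfI : I ≤ Ideal.span (Set.range f) ⊔ I * I * Ideal.span {X})
    (hd : ∀ q : Ideal B, q.IsPrime → q.height ≤ d)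
    (hJ : ∀ q : Ideal B, q.IsPrime → I.comap C ≤ q → (n : ℕ∞) ≤ q.height + 1) {t : B}
    (hst : t - 1 ∈ Ideal.span {s})
    (hs : IsLiftAt I f (C s * X : B[X]) (Ideal.span {X}) vs)
    (ht : IsLiftAt I f (C t * X : B[X]) (Ideal.span {X}) vt) :
    ∃ h ∈ nearConstantSubmonoid (I.comap C) s, ∃ W : Fin n → B[X][X],
      (∀ k, W k - aeval (C (C (s * s) * X) + C (h ^ 2) * X : B[X][X]) (f k) ∈
        Ideal.span {C (C s * X), X} *
          (I.map (aeval (C (C (s * s) * X) + C (h ^ 2) * X : B[X][X])) *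
            I.map (aeval (C (C (s * s) * X) + C (h ^ 2) * X : B[X][X])))) ∧
      ∀ P : Ideal B[X][X], P.IsPrime → (∀ k, W k ∈ P) →
        I.map (aeval (C (C (s * s) * X) + C (h ^ 2) * X : B[X][X])) ≤ P := by
  obtain ⟨M, hM⟩ : ∃ M, M = nearConstantSubmonoid (I.comap C) s := ⟨_, rfl⟩
  have hloc : IsLocalization M E := hM ▸ inferInstance
  have := IsLocalization.isNoetherianRing M E inferInstance
  let _ : Algebra B[X][X] E[X] := Polynomial.algebra B[X] E
  have : IsLocalization (M.map (C : B[X] →+* B[X][X])) E[X] := Polynomial.isLocalization M E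
  obtain ⟨x₀, hx₀⟩ : ∃ x₀ : B[X], x₀ = C (s * s) * X := ⟨_, rfl⟩
  obtain ⟨τ, hτ⟩ : ∃ τ : B[X], τ = C s * X := ⟨_, rfl⟩
  have hF : IsLiftAt I f x₀ (Ideal.span {τ}) ((aeval τ : B[X] →ₐ[B] B[X]) ∘ vs) := by
    have := hs.map (aeval τ : B[X] →ₐ[B] B[X])
    rw [Ideal.map_span, Set.image_singleton, aeval_X, map_mul, aeval_C, aeval_X] at this
    convert this using 1
    rw [hx₀, hτ, algebraMap_eq, C_mul, mul_assoc]
  obtain ⟨F, hFdef⟩ : ∃ F, F = (aeval τ : B[X] →ₐ[B] B[X]) ∘ vs := ⟨_, rfl⟩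
  rw [← hFdef] at hF
  let a : B[X][X] →ₐ[B] E[X] := Polynomial.mapAlgHom (IsScalarTower.toAlgHom B B[X] E)
  have ha : ∀ p, algebraMap B[X][X] E[X] p = a p := fun p => rfl
  have haI : ∀ K : Ideal B[X][X], K.map (algebraMap B[X][X] E[X]) = K.map a := fun p => rfl
  obtain ⟨y, hy⟩ : ∃ y : B[X][X], y = C x₀ + X := ⟨_, rfl⟩
  obtain ⟨g, hg, hg0, hgI⟩ := hF.exists_eval_zero_eq (y := y) (by rw [hy]; simp)
  have haX : a X = X := by rw [← ha]; exact Polynomial.map_X _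
  have haC : ∀ p, a (C p) = C (algebraMap B[X] E p) := fun p => by
    rw [← ha]; exact Polynomial.map_C _
  have ha0 : ∀ p, eval 0 (a p) = algebraMap B[X] E (eval 0 p) := by
    intro p
    change eval 0 (Polynomial.map (algebraMap B[X] E) p) = _
    rw [← map_zero (algebraMap B[X] E), eval_map_apply]
  obtain ⟨𝔱, h𝔱⟩ : ∃ 𝔱 : Ideal B[X][X], 𝔱 = Ideal.span {C τ, X} := ⟨_, rfl⟩
  have hyt : y ∈ 𝔱 := by
    rw [h𝔱, Ideal.mem_span_pair]
    exact ⟨C (C s), 1, by rw [hy, hx₀, hτ, ← C_mul, ← mul_assoc, ← C_mul, one_mul]⟩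
  have hCτ : Ideal.span {C τ} ≤ 𝔱 := h𝔱 ▸ Ideal.span_mono (by simp)
  have hgf : ∀ k, g k - aeval y (f k) ∈ 𝔱 * (I.map (aeval y) * I.map (aeval y)) :=
    fun k => Ideal.mul_mono_left hCτ (hg k)
  have hunit : IsUnit (algebraMap B E[X] t) := by
    have h : IsUnit (algebraMap B[X] E (C t)) :=
      IsLocalization.map_units E (⟨C t, hM ▸ ⟨t, hst, by simp⟩⟩ : M)
    have h' : algebraMap B E[X] t = C (algebraMap B[X] E (C t)) := by
      rw [Polynomial.algebraMap_apply, IsScalarTower.algebraMap_apply B B[X] E, algebraMap_eq]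
    exact h' ▸ h.map C
  obtain ⟨G, hG⟩ := ht.exists_of_isUnit hunit (a y)
  replace hG : IsLiftAt I f (a y) (𝔱.map a) G :=
    hG.mono ((Ideal.span_singleton_le_iff_mem _).2 (Ideal.mem_map_of_mem _ hyt))
  have h𝔱I : (𝔱 * (I.map (aeval y) * I.map (aeval y))).map a =
      𝔱.map a * (I.map (aeval (a y)) * I.map (aeval (a y))) := by
    rw [Ideal.map_mul, Ideal.map_mul, map_map_aeval]
  obtain ⟨W, hW, hWg⟩ := exists_span_range_eq_sub_mem (n := n) (by omega)
    (isPositionRank_nearConstant (E := E) (s := s) hdn hd hJ) (I := I.map (aeval (a y)))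
    (𝔱 := 𝔱.map a)
    (f := fun k => aeval (a y) (f k)) (G := G)
    (F := fun k => a (g k)) (by
      rw [h𝔱, Ideal.map_span, Set.image_pair, haX, haC, Ideal.map_span, Set.image_pair, hτ]
      refine Ideal.span_le.2 ?_
      rintro _ (rfl | rfl)
      · simp
      · simp)
    (fun k => Ideal.mem_map_of_mem _ (hf k))
    (map_aeval_le_sup hfI _ (Ideal.mem_map_of_mem _ hyt)) hG.sub_mem hG.span_eq
    (fun k => by
      rw [← h𝔱I, aeval_algHom_apply, ← map_sub]
      exact Ideal.mem_map_of_mem _ (hgf k))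
    (fun P hP hFP => by
      have h1 : ∀ k, F k ∈ P.comap (algebraMap B[X] E) := fun k => by
        rw [Ideal.mem_comap, ← hg0, ← ha0]; exact hFP k
      have h2 : (I.map (aeval y)).map a ≤ P.comap (evalRingHom 0) :=
        Ideal.map_le_iff_le_comap.2 fun p hp => by
          rw [Ideal.mem_comap, Ideal.mem_comap, coe_evalRingHom, ha0]
          exact hgI _ h1 p hp
      rw [map_map_aeval] at h2
      exact fun p hp => h2 hp)
  obtain ⟨h, hh, W', hW', hW'P⟩ := exists_rescaled_row (R := E[X]) M (I := I.map (aeval y))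
    (IsNoetherian.noetherian _) (g := g) (W := W)
    (fun k => by
      rw [haI, ha, Ideal.map_mul, Ideal.map_mul, map_map_aeval, Ideal.map_span,
        Set.image_singleton, haX]
      exact hWg k)
    (by rw [haI, map_map_aeval, hW])
    (fun P hP h => hgI P fun k => hg0 k ▸ h k)
  let σ : B[X][X] →ₐ[B] B[X][X] := (aeval (C (h ^ 2) * X : B[X][X])).restrictScalars B
  have hσX : σ X = C (h ^ 2) * X := aeval_X _
  have hσC : ∀ p, σ (C p) = C p := fun p => aeval_C _ _
  have hσy : σ y = C (C (s * s) * X) + C (h ^ 2) * X := by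
    rw [hy, map_add, hσC, hσX, hx₀]
  have hσI : (I.map (aeval y)).map (aeval (C (h ^ 2) * X : B[X][X])) =
      I.map (aeval (C (C (s * s) * X) + C (h ^ 2) * X : B[X][X])) := by
    rw [← hσy, ← map_map_aeval]; rfl
  rw [hσI] at hW' hW'P
  refine ⟨h, hM ▸ hh, W', fun k => ?_, hW'P⟩
  have h2 : σ (g k - aeval y (f k)) ∈ 𝔱 *
      (I.map (aeval (C (C (s * s) * X) + C (h ^ 2) * X : B[X][X])) *
        I.map (aeval (C (C (s * s) * X) + C (h ^ 2) * X : B[X][X]))) := by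
    have h3 := Ideal.mem_map_of_mem σ (hg k)
    rw [Ideal.map_mul, Ideal.map_mul, map_map_aeval, hσy, Ideal.map_span, Set.image_singleton,
      hσC] at h3
    exact Ideal.mul_mono_left hCτ h3
  rw [map_sub, ← aeval_algHom_apply, hσy] at h2
  have h1 := Ideal.mul_mono_left (I := Ideal.span {X}) (J := 𝔱)
    (h𝔱 ▸ Ideal.span_mono (by simp)) (hW' k)
  have h3 := add_mem h1 h2
  rw [h𝔱, hτ] at h3
  convert h3 using 1
  exact (sub_add_sub_cancel _ _ _).symm

end LiftAt

section Comaximal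

theorem aeval_sub_mem_span {B : Type*} [CommRing B] (x : B[X]) (p : B[X]) :
    aeval x p - p ∈ Ideal.span {x - X} := by
  have h := sub_dvd_eval_sub x X (p.map C)
  rwa [eval_map, eval_map, ← algebraMap_eq, ← aeval_def, ← aeval_def, aeval_X_left_apply,
    ← Ideal.mem_span_singleton] at h

theorem IsLiftAt.exists_of_comaximal {B : Type*} [CommRing B] [IsNoetherianRing B] {I : Ideal B[X]}
    {s t : B} {d n : ℕ} (hdn : d + 3 ≤ 2 * n)
    {f vs vt : Fin n → B[X]} (hf : ∀ k, f k ∈ I)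
    (hfI : I ≤ Ideal.span (Set.range f) ⊔ I * I * Ideal.span {X})
    (hd : ∀ q : Ideal B, q.IsPrime → q.height ≤ d)
    (hJ : ∀ q : Ideal B, q.IsPrime → I.comap C ≤ q → (n : ℕ∞) ≤ q.height + 1)
    (hst : t - 1 ∈ Ideal.span {s})
    (hs : IsLiftAt I f (C s * X : B[X]) (Ideal.span {X}) vs)
    (ht : IsLiftAt I f (C t * X : B[X]) (Ideal.span {X}) vt) :
    ∃ v : Fin n → B[X], IsLiftAt I f (X : B[X]) (Ideal.span {X}) v := by
  obtain ⟨h, ⟨u, hu, hhu⟩, W, hW, hWP⟩ := exists_bivariate_row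
    (Localization (nearConstantSubmonoid (I.comap C) s)) hdn hf hfI hd hJ hst hs ht
  obtain ⟨b, e, hbe⟩ : IsCoprime (s * s) (u ^ 2) := by
    have : IsCoprime s u := by
      obtain ⟨c, hc⟩ := Ideal.mem_span_singleton'.1 hu
      exact ⟨-c, 1, by linear_combination -hc⟩
    exact (this.mul_left this).pow_right
  let β : B[X] →ₐ[B] B[X] := aeval (C b * X : B[X])
  let ψ : B[X][X] →ₐ[B] B[X] :=
    ((aeval (C e * X : B[X])).restrictScalars B).comp (mapAlgHom β)
  have hψC : ∀ p, ψ (C p) = β p := fun p => by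
    simp [ψ]
  have hψX : ψ X = C e * X := by simp [ψ]
  obtain ⟨x, hx⟩ : ∃ x, x = ψ (C (C (s * s) * X) + C (h ^ 2) * X) := ⟨_, rfl⟩
  have hβ : β h - C u ∈ (I.comap C * I.comap C).map C := by
    have h1 : ∀ K : Ideal B, K.map C ≤ (K.map C).comap β := fun K =>
      Ideal.map_le_iff_le_comap.2 fun r hr => by
        rw [Ideal.mem_comap, Ideal.mem_comap, aeval_C]
        exact Ideal.mem_map_of_mem _ hr
    have h2 := h1 _ hhu
    rwa [Ideal.mem_comap, map_sub, aeval_C] at h2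
  have hxX : x - X = (β h - C u) * (β h + C u) * (C e * X) := by
    rw [hx, map_add, hψC, map_mul ψ, hψC, hψX, map_mul β, map_pow, aeval_C, aeval_X]
    have h1 : (C (s * s) * C b + C u ^ 2 * C e : B[X]) = 1 := by
      rw [← C_mul, ← C_pow, ← C_mul, ← C_add, mul_comm _ b, mul_comm _ e, hbe, C_1]
    rw [algebraMap_eq]
    linear_combination X * h1
  have hJI : (I.comap C).map C ≤ I := Ideal.map_comap_le
  have hxI : x - X ∈ Ideal.span {X} * (I * I) := by
    rw [hxX, mul_comm (_ * _)]
    refine Ideal.mul_mem_mul (Ideal.mul_mem_left _ _ (Ideal.mem_span_singleton_self _))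
      (Ideal.mul_mem_right _ _ ?_)
    rw [Ideal.map_mul] at hβ
    exact Ideal.mul_mono hJI hJI hβ
  have hsub : ∀ p, aeval x p - p ∈ Ideal.span {X} * (I * I) := fun p =>
    (Ideal.span_singleton_le_iff_mem _).2 hxI (aeval_sub_mem_span x p)
  have hXI : Ideal.span {X} * (I * I) ≤ I * I := Ideal.mul_le_right
  have hII : I * I ≤ I := Ideal.mul_le_left
  have hI' : I.map (aeval x) ≤ I := Ideal.map_le_iff_le_comap.2 fun p hp => by
    have := add_mem (hII (hXI (hsub p))) hp
    rwa [sub_add_cancel] at this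
  have hv : ∀ k, ψ (W k) - f k ∈ Ideal.span {X} * (I * I) := fun k => by
    have h1 := Ideal.mem_map_of_mem ψ (hW k)
    rw [Ideal.map_mul, Ideal.map_mul, map_map_aeval, map_sub, ← aeval_algHom_apply, ← hx,
      Ideal.map_span, Set.image_pair, hψC, hψX] at h1
    have h2 : (Ideal.span {β (C s * X), C e * X} : Ideal B[X]) ≤ Ideal.span {X} := by
      refine Ideal.span_le.2 ?_
      rintro _ (rfl | rfl) <;> refine Ideal.mem_span_singleton.2 ?_
      · exact ⟨C s * C b, by rw [map_mul, aeval_C, aeval_X, algebraMap_eq]; ring⟩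
      · exact dvd_mul_left _ _
    have h3 := add_mem (Ideal.mul_mono h2 (Ideal.mul_mono hI' hI') h1) (hsub (f k))
    rwa [sub_add_sub_cancel] at h3
  have hv' : ∀ k, ψ (W k) ∈ I := fun k => by
    have := add_mem (hII (hXI (hv k))) (hf k)
    rwa [sub_add_cancel] at this
  have hid : I.map (aeval (X : B[X])) = I := by
    rw [aeval_X_left]
    exact Ideal.map_id I
  refine ⟨ψ ∘ W, fun k => ?_, ?_⟩
  · rw [hid, aeval_X_left_apply]
    exact hv k
  · rw [hid]
    refine span_range_eq_of_forall_isMaximal (IsNoetherian.noetherian I) hv' ?_ ?_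
    · refine hfI.trans (sup_le (Ideal.span_le.2 ?_) (Ideal.mul_le_left.trans le_sup_right))
      rintro _ ⟨k, rfl⟩
      rw [← sub_sub_cancel (ψ (W k)) (f k)]
      exact Ideal.sub_mem _ (Ideal.mem_sup_left (Ideal.subset_span ⟨k, rfl⟩))
        (Ideal.mem_sup_right (hXI (hv k)))
    · intro M hM hvM p hp
      have h1 : I.map (aeval x) ≤ M := by
        rw [hx, ← map_map_aeval]
        exact Ideal.map_le_iff_le_comap.2 (hWP (M.comap ψ) (hM.isPrime.comap ψ) hvM)
      have h2 : (I.comap C).map C ≤ M := by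
        refine Ideal.map_le_iff_le_comap.2 fun j hj => h1 ?_
        have := Ideal.mem_map_of_mem (aeval x) (Ideal.mem_comap.1 hj)
        rwa [aeval_C] at this
      have h3 : x - X ∈ M := by
        rw [hxX]
        refine Ideal.mul_mem_right _ _ (Ideal.mul_mem_right _ _ (h2 (Ideal.map_mono ?_ hβ)))
        exact Ideal.mul_le_left
      have h4 := Ideal.sub_mem _ (h1 (Ideal.mem_map_of_mem (aeval x) hp))
        ((Ideal.span_singleton_le_iff_mem _).2 h3 (aeval_sub_mem_span x p))
      rwa [sub_sub_cancel] at h4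

end Comaximal

section BaseChange

theorem isLiftAt_map_iff {ι A B R : Type*} [CommRing A] [CommRing B] [CommRing R] [Algebra A B]
    [Algebra A R] [Algebra B R] [IsScalarTower A B R] {I : Ideal A[X]} {f : ι → A[X]} {x : R}
    {t : Ideal R} {v : ι → R} :
    IsLiftAt (I.map (mapRingHom (algebraMap A B))) (fun k => (f k).map (algebraMap A B)) x t v ↔
      IsLiftAt I f x t v := by
  have h : (I.map (mapRingHom (algebraMap A B))).map (aeval x : B[X] →ₐ[B] R) =
      I.map (aeval x : A[X] →ₐ[A] R) := by
    refine le_antisymm (Ideal.map_le_iff_le_comap.2 (Ideal.map_le_iff_le_comap.2 fun p hp => ?_))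
      (Ideal.map_le_iff_le_comap.2 fun p hp => ?_)
    · rw [Ideal.mem_comap, Ideal.mem_comap, coe_mapRingHom, aeval_map_algebraMap]
      exact Ideal.mem_map_of_mem _ hp
    · rw [Ideal.mem_comap, ← aeval_map_algebraMap B]
      exact Ideal.mem_map_of_mem _ (Ideal.mem_map_of_mem (mapRingHom (algebraMap A B)) hp)
  constructor
  · rintro ⟨h1, h2⟩
    refine ⟨fun k => ?_, ?_⟩
    · have := h1 k
      rwa [h, aeval_map_algebraMap] at this
    · rwa [h] at h2
  · rintro ⟨h1, h2⟩
    refine ⟨fun k => ?_, ?_⟩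
    · rw [h, aeval_map_algebraMap]
      exact h1 k
    · rwa [h]

theorem IsLiftAt.exists_of_isCoprime {A B : Type*} [CommRing A] [IsNoetherianRing A] [CommRing B]
    [Algebra A B] (M : Submonoid A) [IsLocalization M B] {I : Ideal A[X]}
    {s t : A} {d n : ℕ} (hdn : d + 3 ≤ 2 * n)
    {f vs vt : Fin n → A[X]} (hf : ∀ k, f k ∈ I)
    (hfI : I ≤ Ideal.span (Set.range f) ⊔ I * I * Ideal.span {X})
    (hd : ∀ q : Ideal A, q.IsPrime → q.height ≤ d)
    (hJ : ∀ q : Ideal A, q.IsPrime → I.comap C ≤ q → (n : ℕ∞) ≤ q.height + 1)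
    (hst : IsCoprime (algebraMap A B s) (algebraMap A B t))
    (hs : IsLiftAt I f (C s * X : A[X]) (Ideal.span {X}) vs)
    (ht : IsLiftAt I f (C t * X : A[X]) (Ideal.span {X}) vt) :
    ∃ v : Fin n → B[X], IsLiftAt I f (X : B[X]) (Ideal.span {X}) v := by
  have := IsLocalization.isNoetherianRing M B inferInstance
  obtain ⟨a, b, hab⟩ := hst
  have key : ∀ {r : A} {v : Fin n → A[X]},
      IsLiftAt I f (C r * X : A[X]) (Ideal.span {X}) v → ∀ c : B,
      ∃ v', IsLiftAt (I.map (mapRingHom (algebraMap A B))) (fun k => (f k).map (algebraMap A B))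
        (C (c * algebraMap A B r) * X : B[X]) (Ideal.span {X}) v' := by
    intro r v hv c
    have h := hv.map (aeval (C c * X : B[X]))
    rw [Ideal.map_span, Set.image_singleton, aeval_X, map_mul, aeval_C, aeval_X,
      Polynomial.algebraMap_apply, mul_left_comm, ← mul_assoc, ← C_mul] at h
    exact ⟨_, isLiftAt_map_iff.2 (h.mono
      (Ideal.span_singleton_le_span_singleton.2 (dvd_mul_left _ _)))⟩
  obtain ⟨vs', hs'⟩ := key hs 1
  obtain ⟨vt', ht'⟩ := key ht b
  have hht : ∀ q : Ideal B, q.IsPrime → q.height = (q.comap (algebraMap A B)).height :=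
    fun q hq => (IsLocalization.height_under M q).symm
  obtain ⟨v, hv⟩ := IsLiftAt.exists_of_comaximal hdn
    (fun k => Ideal.mem_map_of_mem (mapRingHom (algebraMap A B)) (hf k))
    (by
      refine (Ideal.map_mono hfI).trans ?_
      rw [Ideal.map_sup, Ideal.map_mul, Ideal.map_mul, Ideal.map_span, Ideal.map_span,
        Set.image_singleton, ← Set.range_comp, coe_mapRingHom, map_X]
      exact le_rfl)
    (fun q hq => hht q hq ▸ hd _ (hq.comap _))
    (fun q hq h => hht q hq ▸ hJ _ (hq.comap _) fun j hj => h (by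
      have := Ideal.mem_map_of_mem (mapRingHom (algebraMap A B)) (Ideal.mem_comap.1 hj)
      rwa [coe_mapRingHom, map_C] at this))
    (Ideal.mem_span_singleton'.2 ⟨-a, by linear_combination -hab⟩) hs' ht'
  exact ⟨v, isLiftAt_map_iff.1 hv⟩

theorem isLiftAt_algebraMap_X_iff {A L ι : Type*} [CommRing A] [CommRing L] [Algebra A L]
    [Algebra A[X] L] [IsScalarTower A A[X] L] {I : Ideal A[X]} {f : ι → A[X]} {w : ι → L} :
    IsLiftAt I f (algebraMap A[X] L X) (Ideal.span {algebraMap A[X] L X}) w ↔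
      Ideal.span (Set.range w) = I.map (algebraMap A[X] L) ∧
      ∀ k, w k - algebraMap A[X] L (f k) ∈ (I ^ 2 * Ideal.span {X}).map (algebraMap A[X] L) := by
  have hx : ∀ p : A[X], aeval (algebraMap A[X] L X) p = algebraMap A[X] L p := fun p => by
    rw [aeval_algebraMap_apply, aeval_X_left_apply]
  have hxI : I.map (aeval (algebraMap A[X] L X)) = I.map (algebraMap A[X] L) :=
    congrArg Ideal.span (Set.image_congr fun p _ => hx p)
  rw [mul_comm, pow_two, Ideal.map_mul, Ideal.map_mul, Ideal.map_span, Set.image_singleton, ← hxI]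
  exact ⟨fun h => ⟨h.span_eq, fun k => hx (f k) ▸ h.sub_mem k⟩,
    fun h => ⟨fun k => (hx (f k)).symm ▸ h.2 k, h.1⟩⟩

theorem IsLiftAt.exists_of_algHom {A B R ι : Type*} [CommRing A] [CommRing B] [CommRing R]
    [Algebra A B] [Algebra A R] {I : Ideal A[X]} {f : ι → A[X]} {v : ι → B[X]}
    (hv : IsLiftAt I f (X : B[X]) (Ideal.span {X}) v) (g : B →ₐ[A] R) (x : R) :
    ∃ w : ι → R, IsLiftAt I f x (Ideal.span {x}) w := by
  let _ : Algebra B R := g.toRingHom.toAlgebra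
  have : IsScalarTower A B R := .of_algebraMap_eq' g.comp_algebraMap.symm
  have h := hv.map ((aeval x : B[X] →ₐ[B] R).restrictScalars A)
  rw [Ideal.map_span, Set.image_singleton, AlgHom.restrictScalars_apply, aeval_X] at h
  exact ⟨_, h⟩

theorem IsLiftAt.exists_of_isLocalization {A L ι : Type*} [CommRing A] [CommRing L] [Algebra A L]
    [Algebra A[X] L] [IsScalarTower A A[X] L] [Finite ι] (M : Submonoid A)
    [IsLocalization (M.map (C : A →+* A[X])) L] {I : Ideal A[X]} (hI : I.FG) {f : ι → A[X]}
    (hf : ∀ k, f k ∈ I) (hfI : I ≤ Ideal.span (Set.range f) ⊔ I * I * Ideal.span {X})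
    {w : ι → L} (hw : IsLiftAt I f (algebraMap A[X] L X) (Ideal.span {algebraMap A[X] L X}) w) :
    ∃ h ∈ M, ∃ v : ι → A[X], IsLiftAt I f (C h * X : A[X]) (Ideal.span {X}) v := by
  obtain ⟨hw1, hw2⟩ := isLiftAt_algebraMap_X_iff.1 hw
  obtain ⟨h, hh, v, hv, hvP⟩ := exists_rescaled_row M hI (g := f) (W := w)
    (fun k => by
      rw [mul_comm, ← pow_two]
      exact hw2 k) hw1.ge
    (fun P hP h p hp => by
      have : I ≤ P.comap (evalRingHom 0) := by
        refine hfI.trans (sup_le (Ideal.span_le.2 ?_) (Ideal.mul_le_right.trans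
          ((Ideal.span_singleton_le_iff_mem _).2 (by simp))))
        rintro _ ⟨k, rfl⟩
        exact h k
      exact this hp)
  refine ⟨h ^ 2, pow_mem hh 2, v, hv, span_range_eq_of_forall_isMaximal (hI.map _) (fun k => ?_) ?_
    fun P hP h => hvP P hP.isPrime h⟩
  all_goals
    have hle : Ideal.span {X} * (I.map (aeval (C (h ^ 2) * X : A[X])) *
      I.map (aeval (C (h ^ 2) * X : A[X]))) ≤ I.map (aeval (C (h ^ 2) * X : A[X])) *
        I.map (aeval (C (h ^ 2) * X : A[X])) := Ideal.mul_le_right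
  · have := Ideal.add_mem _ (Ideal.mul_le_left (hle (hv k))) (Ideal.mem_map_of_mem (aeval _) (hf k))
    rwa [sub_add_cancel] at this
  · refine (map_aeval_le_sup hfI _ (Ideal.mul_mem_left _ _
      (Ideal.mem_span_singleton_self _))).trans
      (sup_le (Ideal.span_le.2 ?_) (hle.trans le_sup_right))
    rintro _ ⟨k, rfl⟩
    have := Ideal.sub_mem (Ideal.span (Set.range v) ⊔ I.map (aeval (C (h ^ 2) * X : A[X])) *
        I.map (aeval (C (h ^ 2) * X : A[X])))
      (Ideal.mem_sup_left (Ideal.subset_span ⟨k, rfl⟩)) (Ideal.mem_sup_right (hle (hv k)))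
    rwa [sub_sub_cancel] at this

end BaseChange

section LinearMaps

theorem range_eq_span_range_of_basis {R ι : Type*} [CommRing R] [Finite ι] [DecidableEq ι]
    (S : Submonoid R)
    (Ψ : LocalizedModule S (ι → R) →ₗ[Localization S] Localization S) :
    LinearMap.range Ψ =
      Ideal.span (Set.range fun k => Ψ (LocalizedModule.mkLinearMap S _ (Pi.single k 1))) := by
  have h := span_eq_top_of_isLocalizedModule (Localization S) S
    (LocalizedModule.mkLinearMap S (ι → R)) (Pi.basisFun R ι).span_eq
  rw [LinearMap.range_eq_map, ← h, Submodule.map_span, ← Set.range_comp, ← Set.range_comp]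
  congr 2
  ext k
  simp [Function.comp]

theorem exists_linearMap_localization_iff {R ι : Type*} [CommRing R] [Fintype ι] [DecidableEq ι]
    (S : Submonoid R) (φ : (ι → R) →ₗ[R] R) (K : Ideal (Localization S))
    (Q : Ideal (Localization S)) :
    (∃ Ψ : LocalizedModule S (ι → R) →ₗ[Localization S] Localization S,
      LinearMap.range Ψ = K ∧ ∀ v, Ψ (LocalizedModule.mkLinearMap S (ι → R) v) -
        algebraMap R (Localization S) (φ v) ∈ Q) ↔
    ∃ w : ι → Localization S, Ideal.span (Set.range w) = K ∧
      ∀ k, w k - algebraMap R (Localization S) (φ (Pi.single k 1)) ∈ Q := by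
  constructor
  · rintro ⟨Ψ, hK, hQ⟩
    exact ⟨_, (range_eq_span_range_of_basis S Ψ).symm.trans hK, fun k => hQ _⟩
  · rintro ⟨w, hK, hQ⟩
    obtain ⟨Ψ, hΨ⟩ : ∃ Ψ : LocalizedModule S (ι → R) →ₗ[Localization S] Localization S,
        ∀ v, Ψ (LocalizedModule.mkLinearMap S (ι → R) v) = ∑ k, v k • w k := by
      refine ⟨LinearMap.extendScalarsOfIsLocalization S (Localization S)
        (IsLocalizedModule.lift S (LocalizedModule.mkLinearMap S (ι → R))
          (Fintype.linearCombination R w)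
          (IsLocalizedModule.map_units (Algebra.linearMap R (Localization S)))), fun v => ?_⟩
      rw [LinearMap.extendScalarsOfIsLocalization_apply', IsLocalizedModule.lift_apply,
        Fintype.linearCombination_apply]
    refine ⟨Ψ, ?_, fun v => ?_⟩
    · rw [range_eq_span_range_of_basis, ← hK]
      congr 2
      ext k
      rw [hΨ]
      simp [Pi.single_apply]
    · have hv : φ v = ∑ k, v k * φ (Pi.single k 1) := by
        conv_lhs => rw [← Finset.univ_sum_single v, map_sum]
        refine Finset.sum_congr rfl fun k _ => ?_
        rw [← smul_eq_mul, ← map_smul, ← Pi.single_smul, smul_eq_mul, mul_one]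
      rw [hΨ, hv, map_sum, ← Finset.sum_sub_distrib]
      refine Ideal.sum_mem _ fun k _ => ?_
      rw [map_mul, Algebra.smul_def, ← mul_sub]
      exact Ideal.mul_mem_left _ _ (hQ k)

end LinearMaps

section Hypotheses

theorem le_height_comap_C_add_one {A : Type*} [CommRing A] [IsNoetherianRing A] {n : ℕ}
    {I : Ideal A[X]} (hI : idealHt I = n) (q : Ideal A) [q.IsPrime] (hq : I.comap C ≤ q) :
    (n : ℕ∞) ≤ q.height + 1 := by
  obtain ⟨q₀, hq₀, hle⟩ := Ideal.exists_minimalPrimes_le hq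
  obtain ⟨P, hP, hPq⟩ := Ideal.exists_minimalPrimes_comap_eq C q₀ hq₀
  have hPp : P.IsPrime := hP.1.1
  have h0 : idealHt I ≤ ringKrullDim (Localization.AtPrime P) :=
    iInf₂_le (⟨P, hPp⟩ : PrimeSpectrum A[X]) hP.1.2
  rw [hI, IsLocalization.AtPrime.ringKrullDim_eq_height P (Localization.AtPrime P)] at h0
  have h2 : (n : ℕ∞) ≤ P.height := WithBot.coe_le_coe.1 h0
  refine h2.trans ((height_le_height_comap_C_add_one P).trans ?_)
  rw [hPq]
  exact add_le_add_left (Ideal.height_mono hle) 1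

theorem height_le_of_ringKrullDim_eq {A : Type*} [CommRing A] {d : ℕ} (hdim : ringKrullDim A = d)
    (q : Ideal A) (hq : q.IsPrime) : q.height ≤ d := by
  have := Ideal.height_le_ringKrullDim_of_ne_top hq.ne_top
  rw [hdim] at this
  exact_mod_cast this

end Hypotheses

/-- (Proposition 7.5) Let `A` be Noetherian of dimension `d` containing an infinite field `k`
with singular locus `V(𝒥)`, `ht 𝒥 ≥ d − n + 2`, `2n ≥ d + 3`.  Let `I ⊆ A[T]` be an ideal of
height `n` and `φ : A[T]^n → I` induce a surjection onto `I/I²T`.  Then the set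
`N(I; φ)` of all `s ∈ A` such that `φ ⊗ A_s[T]` lifts to a surjection `A_s[T]^n ↠ I_s` is an
ideal of `A`. -/
theorem stmt15 (k A : Type*) [Field k] [Infinite k] [CommRing A] [IsNoetherianRing A]
    [Algebra k A] (d n : ℕ) (hdim : ringKrullDim A = d) (hn : d + 3 ≤ 2 * n)
    (𝒥 : Ideal A)
    (hsing : ∀ p : PrimeSpectrum A, ¬ RegularAt A p ↔ 𝒥 ≤ p.asIdeal)
    (hht : ∀ m : ℕ, (m : ℤ) = (d : ℤ) - n + 2 → (m : WithBot (WithTop ℕ)) ≤ idealHt 𝒥)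
    (I : Ideal (Polynomial A)) (hI : idealHt I = n)
    (φ : (Fin n → Polynomial A) →ₗ[Polynomial A] Polynomial A)
    (hφI : LinearMap.range φ ≤ I)
    (hφsurj : LinearMap.range φ ⊔
      ((I ^ 2 * Ideal.span {(X : Polynomial A)}) :
        Submodule (Polynomial A) (Polynomial A)) = I) :
    ∃ N : Ideal A, ∀ s : A,
      s ∈ N ↔
        ∃ Ψ : (LocalizedModule
            (Submonoid.map (algebraMap A (Polynomial A)).toMonoidHom (Submonoid.powers s))
            (Fin n → Polynomial A))
          →ₗ[Localization
            (Submonoid.map (algebraMap A (Polynomial A)).toMonoidHom (Submonoid.powers s))]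
          Localization
            (Submonoid.map (algebraMap A (Polynomial A)).toMonoidHom (Submonoid.powers s)),
          LinearMap.range Ψ =
            (I.map (algebraMap (Polynomial A) (Localization
              (Submonoid.map (algebraMap A (Polynomial A)).toMonoidHom (Submonoid.powers s)))) :
            Ideal _) ∧
          ∀ v, Ψ (LocalizedModule.mkLinearMap _ (Fin n → Polynomial A) v) -
              algebraMap (Polynomial A) _ (φ v) ∈
            (I ^ 2 * Ideal.span {(X : Polynomial A)}).map
              (algebraMap (Polynomial A) (Localization
                (Submonoid.map (algebraMap A (Polynomial A)).toMonoidHom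
                  (Submonoid.powers s)))) := by
  let f : Fin n → A[X] := fun k => φ (Pi.single k 1)
  have hf : ∀ k, f k ∈ I := fun k => hφI ⟨_, rfl⟩
  have hfI : I ≤ Ideal.span (Set.range f) ⊔ I * I * Ideal.span {X} := by
    have h : LinearMap.range φ = Ideal.span (Set.range f) := by
      rw [LinearMap.range_eq_map, ← (Pi.basisFun A[X] (Fin n)).span_eq, Submodule.map_span,
        ← Set.range_comp]
      congr 2
      ext1 k
      simp [f]
    rw [← h, ← pow_two]
    exact hφsurj.ge
  let L : A → Type _ := fun s => Localization
    (Submonoid.map (algebraMap A (Polynomial A)).toMonoidHom (Submonoid.powers s))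
  have hL : ∀ s, IsLocalization ((Submonoid.powers s).map (C : A →+* A[X])) (L s) := fun s =>
    inferInstanceAs (IsLocalization
      (Submonoid.map (algebraMap A (Polynomial A)).toMonoidHom (Submonoid.powers s)) (L s))
  have hunit : ∀ s, IsUnit (algebraMap A (L s) s) := fun s => by
    rw [IsScalarTower.algebraMap_apply A A[X] (L s)]
    exact IsLocalization.map_units (L s)
      (⟨C s, s, Submonoid.mem_powers s, rfl⟩ : (Submonoid.powers s).map (C : A →+* A[X]))
  let N : Set A := {s | ∃ w : Fin n → L s,
    IsLiftAt I f (algebraMap A[X] (L s) X) (Ideal.span {algebraMap A[X] (L s) X}) w}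
  have hN : ∀ s ∈ N, ∃ m : ℕ, ∃ v : Fin n → A[X],
      IsLiftAt I f (C (s ^ m) * X : A[X]) (Ideal.span {X}) v := by
    rintro s ⟨w, hw⟩
    obtain ⟨_, ⟨m, rfl⟩, v, hv⟩ := hw.exists_of_isLocalization (Submonoid.powers s)
      (IsNoetherian.noetherian I) hf hfI
    exact ⟨m, v, hv⟩
  refine ⟨{
    carrier := N
    add_mem' := ?_
    zero_mem' := ?_
    smul_mem' := ?_ }, fun s => ?_⟩
  · intro s t hs ht
    obtain ⟨a, vs, hvs⟩ := hN s hs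
    obtain ⟨b, vt, hvt⟩ := hN t ht
    have hcop : IsCoprime (algebraMap A (Localization.Away (s + t)) (s ^ a))
        (algebraMap A (Localization.Away (s + t)) (t ^ b)) := by
      obtain ⟨c, hc⟩ := (IsLocalization.Away.algebraMap_isUnit
        (S := Localization.Away (s + t)) (s + t)).exists_left_inv
      rw [map_pow, map_pow]
      exact IsCoprime.pow ⟨c, c, by rw [← mul_add, ← map_add, hc]⟩
    obtain ⟨v, hv⟩ := IsLiftAt.exists_of_isCoprime (Submonoid.powers (s + t)) hn hf hfI
      (height_le_of_ringKrullDim_eq hdim) (fun q _ => le_height_comap_C_add_one hI q) hcop hvs hvt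
    refine hv.exists_of_algHom (IsLocalization.liftAlgHom (M := Submonoid.powers (s + t))
      (f := Algebra.ofId A (L (s + t))) ?_) _
    rintro ⟨_, m, rfl⟩
    simpa using (hunit (s + t)).pow m
  · have := hunit 0
    rw [map_zero, isUnit_zero_iff] at this
    have : Subsingleton (L 0) := subsingleton_of_zero_eq_one this
    refine ⟨0, fun k => ?_, Subsingleton.elim _ _⟩
    rw [Subsingleton.elim (_ - _) (0 : L 0)]
    exact zero_mem _
  · intro c s hs
    obtain ⟨m, v, hv⟩ := hN s hs
    refine hv.exists_of_isUnit ?_ _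
    have := hunit (c • s)
    rw [smul_eq_mul, map_mul] at this
    rw [map_pow]
    exact (isUnit_of_mul_isUnit_right this).pow m
  · rw [exists_linearMap_localization_iff]
    exact exists_congr fun w => isLiftAt_algebraMap_X_iff
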